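/- arXiv:1301.5895 — 3 statements merged into one kernel-verified Lean document; each statement's English description precedes it below -/
import Mathlib

section
/- The ball B³ is inextensible: every origin-symmetric convex body K in ℝ³ that properly contains B³ satisfies d_K > d_{B³}, where d_K is the critical covering determinant of K. -/
open Set Pointwise MeasureTheory

noncomputable section

abbrev Euc (n : ℕ) := EuclideanSpace ℝ (Fin n)

/-- An origin-symmetric convex body in `ℝⁿ`: compact, convex, nonempty interior, `K = -K`. -/
def IsSymmConvexBody {n : ℕ} (K : Set (Euc n)) : Prop :=
  IsCompact K ∧ Convex ℝ K ∧ (interior K).Nonempty ∧ K = -K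

/-- The closed Euclidean unit ball `Bⁿ`. -/
def unitBall (n : ℕ) : Set (Euc n) := Metric.closedBall 0 1

/-- The set of integer points `ℤⁿ ⊆ ℝⁿ`. -/
def intPoints (n : ℕ) : Set (Euc n) := {x | ∀ i, ∃ m : ℤ, x i = (m : ℝ)}

/-- The lattice `Λ = T(ℤⁿ)` is a covering lattice for `K`:
the translates of `K` by lattice vectors cover all of `ℝⁿ`. -/
def IsCoveringLattice {n : ℕ} (T : Euc n →ₗ[ℝ] Euc n) (K : Set (Euc n)) : Prop :=
  (⋃ l ∈ T '' intPoints n, (l +ᵥ K)) = Set.univ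

/-- The critical covering determinant `d_K`: the supremum of the determinants
`d(Λ) = |det T|` over all covering lattices `Λ = T(ℤⁿ)` of `K`. -/
def critCoveringDet {n : ℕ} (K : Set (Euc n)) : ℝ :=
  sSup {d | ∃ T : Euc n →ₗ[ℝ] Euc n,
    LinearMap.det T ≠ 0 ∧ IsCoveringLattice T K ∧ d = |LinearMap.det T|}

/-- The determinant of three vectors of `ℝ³`. -/
def det3 (a b c : Euc 3) : ℝ :=
  a 0 * (b 1 * c 2 - b 2 * c 1) - a 1 * (b 0 * c 2 - b 2 * c 0) + a 2 * (b 0 * c 1 - b 1 * c 0)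

lemma inner_euc3 (a b : Euc 3) : inner ℝ a b = a 0 * b 0 + a 1 * b 1 + a 2 * b 2 := by
  simp [PiLp.inner_apply, Fin.sum_univ_three, mul_comm]

lemma norm_sq_euc3 (a : Euc 3) : ‖a‖ ^ 2 = a 0 ^ 2 + a 1 ^ 2 + a 2 ^ 2 := by
  simp [EuclideanSpace.real_norm_sq_eq, Fin.sum_univ_three]

lemma exists_inner_eq {a b c : Euc 3} (h : det3 a b c ≠ 0) (α β γ : ℝ) :
    ∃ x : Euc 3, inner ℝ x a = α ∧ inner ℝ x b = β ∧ inner ℝ x c = γ := by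
  refine ⟨!₂[(α * (b 1 * c 2 - b 2 * c 1) + β * (c 1 * a 2 - c 2 * a 1)
      + γ * (a 1 * b 2 - a 2 * b 1)) / det3 a b c,
    (α * (b 2 * c 0 - b 0 * c 2) + β * (c 2 * a 0 - c 0 * a 2)
      + γ * (a 2 * b 0 - a 0 * b 2)) / det3 a b c,
    (α * (b 0 * c 1 - b 1 * c 0) + β * (c 0 * a 1 - c 1 * a 0)
      + γ * (a 0 * b 1 - a 1 * b 0)) / det3 a b c], ?_, ?_, ?_⟩ <;>
  · simp only [inner_euc3, Matrix.cons_val_zero, Matrix.cons_val_one,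
      Matrix.cons_val]
    field_simp
    simp only [det3]
    ring

lemma det3_sq_le (p q s : Euc 3) :
    det3 p q s ^ 2 ≤ ((‖p‖ ^ 2 + ‖q‖ ^ 2 + ‖s‖ ^ 2) / 3) ^ 3 := by
  have hadamard : det3 p q s ^ 2 ≤ ‖p‖ ^ 2 * (‖q‖ ^ 2 * ‖s‖ ^ 2) := by
    set w : Euc 3 := !₂[q 1 * s 2 - q 2 * s 1, q 2 * s 0 - q 0 * s 2, q 0 * s 1 - q 1 * s 0]
      with hw
    have hdet : det3 p q s = inner ℝ p w := by
      simp [inner_euc3, hw, det3]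
      ring
    have hcross : ‖w‖ ^ 2 = ‖q‖ ^ 2 * ‖s‖ ^ 2 - inner ℝ q s ^ 2 := by
      simp [norm_sq_euc3, inner_euc3, hw]
      ring
    have h1 : inner ℝ p w ^ 2 ≤ ‖p‖ ^ 2 * ‖w‖ ^ 2 := by
      rw [← mul_pow, ← sq_abs]
      exact pow_le_pow_left₀ (abs_nonneg _) (abs_real_inner_le_norm p w) 2
    rw [hdet]
    refine h1.trans (mul_le_mul_of_nonneg_left ?_ (sq_nonneg _))
    rw [hcross]
    linarith [sq_nonneg (inner ℝ q s)]
  have amgm : ∀ x y z : ℝ, 0 ≤ x → 0 ≤ y → 0 ≤ z → x * (y * z) ≤ ((x + y + z) / 3) ^ 3 := by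
    intro x y z hx hy hz
    nlinarith [mul_nonneg hx (sq_nonneg (y - z)), mul_nonneg hy (sq_nonneg (x - z)),
      mul_nonneg hz (sq_nonneg (x - y)), mul_nonneg (add_nonneg (add_nonneg hx hy) hz)
        (add_nonneg (add_nonneg (sq_nonneg (x - y)) (sq_nonneg (y - z))) (sq_nonneg (x - z)))]
  exact hadamard.trans (amgm _ _ _ (sq_nonneg _) (sq_nonneg _) (sq_nonneg _))

/-- The balls of radius `r` about the integer combinations of `a, b, c` cover `ℝ³`. -/
def CoversBy (a b c : Euc 3) (r : ℝ) : Prop :=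
  ∀ p : Euc 3, ∃ m n k : ℤ, ‖p - ((m : ℝ) • a + (n : ℝ) • b + (k : ℝ) • c)‖ ≤ r

/-- With `-(a + b + c)`, the vectors `a, b, c` form a superbase with no acute angle. -/
def ObtuseSuperbase (a b c : Euc 3) : Prop :=
  inner ℝ a b ≤ 0 ∧ inner ℝ a c ≤ 0 ∧ inner ℝ b c ≤ 0 ∧
    0 ≤ inner ℝ a (a + b + c) ∧ 0 ≤ inner ℝ b (a + b + c) ∧ 0 ≤ inner ℝ c (a + b + c)

lemma CoversBy.rotate {a b c : Euc 3} {r : ℝ} (h : CoversBy a b c r) : CoversBy b c a r := by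
  intro p
  obtain ⟨m, n, k, hp⟩ := h p
  refine ⟨n, k, m, ?_⟩
  rwa [← add_rotate]

/-- The sphere circumscribed about `0, a, a + b, a + b + c` contains no lattice point inside, and
its squared radius is at least a sixteenth of the sum of the squared edges. -/
lemma edges_le_of_covers {a b c : Euc 3} {r : ℝ} (hcov : CoversBy a b c r)
    (hdet : det3 a b c ≠ 0) (hob : ObtuseSuperbase a b c) :
    ‖a‖ ^ 2 + ‖b‖ ^ 2 + ‖c‖ ^ 2 + ‖a + b + c‖ ^ 2 + ‖a + b‖ ^ 2 + ‖b + c‖ ^ 2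
      ≤ 16 * r ^ 2 := by
  obtain ⟨x, hxa, hxb, hxc⟩ := exists_inner_eq hdet (inner ℝ a a / 2)
    (inner ℝ b b / 2 + inner ℝ a b) (inner ℝ c c / 2 + inner ℝ a c + inner ℝ b c)
  obtain ⟨m, n, k, hl⟩ := hcov x
  obtain ⟨hab, hac, hbc, ha, hb, hc⟩ := hob
  have int_sq : ∀ j : ℤ, (0 : ℝ) ≤ (j : ℝ) ^ 2 - j := by
    intro j
    have : 0 ≤ j ^ 2 - j := by
      rcases le_or_gt j 0 with h | h <;> nlinarith
    exact_mod_cast this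
  have h1 := int_sq m
  have h2 := int_sq n
  have h3 := int_sq k
  have h4 := int_sq (m - n)
  have h5 := int_sq (m - k)
  have h6 := int_sq (n - k)
  push_cast at h4 h5 h6
  have hl2 : ‖x - ((m : ℝ) • a + (n : ℝ) • b + (k : ℝ) • c)‖ ^ 2 ≤ r ^ 2 :=
    pow_le_pow_left₀ (norm_nonneg _) hl 2
  have hg : 0 ≤ ‖x - (1 / 4 : ℝ) • (a + (a + b) + (a + b + c))‖ ^ 2 := sq_nonneg _
  simp only [← real_inner_self_eq_norm_sq, inner_add_left, inner_add_right, inner_sub_left,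
    inner_sub_right, inner_smul_left, inner_smul_right, real_inner_comm x, hxa, hxb, hxc,
    real_inner_comm a b, real_inner_comm a c, real_inner_comm b c, conj_trivial] at *
  have q1 := mul_nonneg ha h1
  have q2 := mul_nonneg hb h2
  have q3 := mul_nonneg hc h3
  have q4 := mul_nonneg (neg_nonneg.2 hab) h4
  have q5 := mul_nonneg (neg_nonneg.2 hac) h5
  have q6 := mul_nonneg (neg_nonneg.2 hbc) h6
  linarith

lemma finite_span_inter_closedBall {a b c : Euc 3} (hdet : det3 a b c ≠ 0) (R : ℝ) :
    {v : Euc 3 | v ∈ Submodule.span ℤ {a, b, c} ∧ ‖v‖ ≤ R}.Finite := by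
  obtain ⟨x, hxa, hxb, hxc⟩ := exists_inner_eq hdet 1 0 0
  obtain ⟨y, hya, hyb, hyc⟩ := exists_inner_eq hdet 0 1 0
  obtain ⟨z, hza, hzb, hzc⟩ := exists_inner_eq hdet 0 0 1
  have bound : ∀ (w v : Euc 3) (j : ℤ), inner ℝ w v = (j : ℝ) → ‖v‖ ≤ R →
      j ∈ Set.Icc (-⌈‖w‖ * R⌉) ⌈‖w‖ * R⌉ := by
    intro w v j hj hv
    have h1 : |(j : ℝ)| ≤ ⌈‖w‖ * R⌉ := by
      rw [← hj]
      exact (abs_real_inner_le_norm w v).trans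
        ((mul_le_mul_of_nonneg_left hv (norm_nonneg w)).trans (Int.le_ceil _))
    rw [abs_le] at h1
    exact ⟨by exact_mod_cast h1.1, by exact_mod_cast h1.2⟩
  refine (((Set.finite_Icc (-⌈‖x‖ * R⌉) ⌈‖x‖ * R⌉).prod
    ((Set.finite_Icc (-⌈‖y‖ * R⌉) ⌈‖y‖ * R⌉).prod
      (Set.finite_Icc (-⌈‖z‖ * R⌉) ⌈‖z‖ * R⌉))).image
    fun t : ℤ × ℤ × ℤ ↦ t.1 • a + t.2.1 • b + t.2.2 • c).subset ?_
  rintro v ⟨hv, hvR⟩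
  obtain ⟨m, n, k, rfl⟩ := Submodule.mem_span_triple.1 hv
  refine ⟨(m, n, k), ⟨bound x _ m ?_ hvR, bound y _ n ?_ hvR, bound z _ k ?_ hvR⟩, rfl⟩ <;>
  simp [← Int.cast_smul_eq_zsmul ℝ, inner_add_right, inner_smul_right, *]

/-- Selling reduction: a superbase of least energy is obtuse. -/
lemma exists_obtuse_superbase {a b c : Euc 3} {r : ℝ} (hcov : CoversBy a b c r)
    (hdet : det3 a b c ≠ 0) :
    ∃ a' b' c' : Euc 3, CoversBy a' b' c' r ∧ |det3 a' b' c'| = |det3 a b c| ∧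
      ObtuseSuperbase a' b' c' := by
  set L := Submodule.span ℤ {a, b, c} with hL
  set E : Euc 3 × Euc 3 × Euc 3 → ℝ := fun t ↦
    ‖t.1‖ ^ 2 + ‖t.2.1‖ ^ 2 + ‖t.2.2‖ ^ 2 + ‖t.1 + t.2.1 + t.2.2‖ ^ 2 with hE
  set G : Set (Euc 3 × Euc 3 × Euc 3) := {t | (t.1 ∈ L ∧ t.2.1 ∈ L ∧ t.2.2 ∈ L) ∧
    CoversBy t.1 t.2.1 t.2.2 r ∧ |det3 t.1 t.2.1 t.2.2| = |det3 a b c|} with hG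
  have h0 : (a, b, c) ∈ G :=
    ⟨⟨Submodule.subset_span (by simp), Submodule.subset_span (by simp),
      Submodule.subset_span (by simp)⟩, hcov, rfl⟩
  have hfin : {t | t ∈ G ∧ E t ≤ E (a, b, c)}.Finite := by
    have hF := finite_span_inter_closedBall hdet √(E (a, b, c))
    refine (hF.prod (hF.prod hF)).subset ?_
    rintro ⟨u, v, w⟩ ⟨⟨⟨hu, hv, hw⟩, -⟩, ht⟩
    have hle : ‖u‖ ^ 2 + ‖v‖ ^ 2 + ‖w‖ ^ 2 + ‖u + v + w‖ ^ 2 ≤ E (a, b, c) := ht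
    exact ⟨⟨hu, Real.le_sqrt_of_sq_le (by nlinarith [sq_nonneg ‖v‖, sq_nonneg ‖w‖])⟩,
      ⟨hv, Real.le_sqrt_of_sq_le (by nlinarith [sq_nonneg ‖u‖, sq_nonneg ‖w‖])⟩,
      ⟨hw, Real.le_sqrt_of_sq_le (by nlinarith [sq_nonneg ‖u‖, sq_nonneg ‖v‖])⟩⟩
  obtain ⟨⟨u, v, w⟩, ⟨⟨⟨hu, hv, hw⟩, huvw, hd⟩, hle⟩, hmin⟩ :=
    Set.exists_min_image _ E hfin ⟨(a, b, c), h0, le_rfl⟩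
  simp only at hu hv hw huvw hd
  have key : ∀ u' v' w' : Euc 3, u' ∈ L → v' ∈ L → w' ∈ L → CoversBy u' v' w' r →
      |det3 u' v' w'| = |det3 u v w| → E (u, v, w) ≤ E (u', v', w') := by
    intro u' v' w' hu' hv' hw' hc' hd'
    by_contra! hlt
    exact absurd (hmin (u', v', w') ⟨⟨⟨hu', hv', hw'⟩, hc', hd'.trans hd⟩, hlt.le.trans hle⟩)
      (not_le.2 hlt)
  have cover : ∀ {u' v' w' : Euc 3}, (∀ m n k : ℤ, ∃ m' n' k' : ℤ,
      (m' : ℝ) • u' + (n' : ℝ) • v' + (k' : ℝ) • w' = (m : ℝ) • u + (n : ℝ) • v + (k : ℝ) • w) →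
      CoversBy u' v' w' r := by
    intro u' v' w' h p
    obtain ⟨m, n, k, hp⟩ := huvw p
    obtain ⟨m', n', k', h'⟩ := h m n k
    exact ⟨m', n', k', h' ▸ hp⟩
  have det_eq : ∀ {u' v' w' : Euc 3}, det3 u' v' w' = - det3 u v w →
      |det3 u' v' w'| = |det3 u v w| := fun h ↦ by rw [h, abs_neg]
  have k1 := key (-u) v (w + u) (neg_mem hu) hv (add_mem hw hu)
    (cover fun m n k ↦ ⟨k - m, n, k, by push_cast; module⟩)
    (det_eq (by simp [det3]; ring))
  have k2 := key (-u) (v + u) w (neg_mem hu) (add_mem hv hu) hw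
    (cover fun m n k ↦ ⟨n - m, n, k, by push_cast; module⟩)
    (det_eq (by simp [det3]; ring))
  have k3 := key (u + v) (-v) w (add_mem hu hv) (neg_mem hv) hw
    (cover fun m n k ↦ ⟨m, m - n, k, by push_cast; module⟩)
    (det_eq (by simp [det3]; ring))
  have k4 := key (-u) (v + u) (w + u) (neg_mem hu) (add_mem hv hu) (add_mem hw hu)
    (cover fun m n k ↦ ⟨n + k - m, n, k, by push_cast; module⟩)
    (det_eq (by simp [det3]; ring))
  have k5 := key (u + v) (-v) (w + v) (add_mem hu hv) (neg_mem hv) (add_mem hw hv)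
    (cover fun m n k ↦ ⟨m, m + k - n, k, by push_cast; module⟩)
    (det_eq (by simp [det3]; ring))
  have k6 := key (u + w) (v + w) (-w) (add_mem hu hw) (add_mem hv hw) (neg_mem hw)
    (cover fun m n k ↦ ⟨m, n, m + n - k, by push_cast; module⟩)
    (det_eq (by simp [det3]; ring))
  refine ⟨u, v, w, huvw, hd, ?_⟩
  simp only [hE, norm_sq_euc3, PiLp.add_apply, PiLp.neg_apply] at k1 k2 k3 k4 k5 k6
  simp only [ObtuseSuperbase, inner_euc3, PiLp.add_apply]
  refine ⟨?_, ?_, ?_, ?_, ?_, ?_⟩ <;> linarith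

/-- The body-centred cubic lattice bounds the determinant of a lattice covering by balls. -/
lemma det3_sq_le_of_covers {a b c : Euc 3} {r : ℝ} (hcov : CoversBy a b c r) :
    4 * det3 a b c ^ 2 ≤ (16 * r ^ 2 / 5) ^ 3 := by
  by_cases hdet : det3 a b c = 0
  · rw [hdet, zero_pow two_ne_zero, mul_zero]
    positivity
  obtain ⟨u, v, w, hc, hd, hob⟩ := exists_obtuse_superbase hcov hdet
  have hdet' : det3 u v w ≠ 0 := by
    rwa [← abs_pos, hd, abs_pos]
  have hrot : ∀ {u v w : Euc 3}, ObtuseSuperbase u v w → ObtuseSuperbase v w u := by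
    rintro u v w ⟨h1, h2, h3, h4, h5, h6⟩
    rw [ObtuseSuperbase, ← add_rotate u v w, real_inner_comm u v, real_inner_comm u w]
    exact ⟨h3, h1, h2, h5, h6, h4⟩
  have hdrot : ∀ u v w : Euc 3, det3 v w u = det3 u v w := fun u v w ↦ by
    simp only [det3]
    ring
  have e1 := edges_le_of_covers hc hdet' hob
  have e2 := edges_le_of_covers hc.rotate (by rwa [hdrot]) (hrot hob)
  have e3 := edges_le_of_covers hc.rotate.rotate (by rwa [hdrot, hdrot]) (hrot (hrot hob))
  have hH := det3_sq_le (u + v) (v + w) (w + u)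
  have h2 : det3 (u + v) (v + w) (w + u) = 2 * det3 u v w := by
    simp [det3]
    ring
  rw [h2] at hH
  rw [← sq_abs, ← hd, sq_abs]
  refine le_trans (by linarith) (hH.trans (pow_le_pow_left₀ (by positivity) ?_ 3))
  simp only [norm_sq_euc3, PiLp.add_apply] at *
  linarith

lemma det_eq_det3 (T : Euc 3 →ₗ[ℝ] Euc 3) :
    LinearMap.det T = det3 (T (EuclideanSpace.single 0 1)) (T (EuclideanSpace.single 1 1))
      (T (EuclideanSpace.single 2 1)) := by
  rw [← LinearMap.det_toMatrix (EuclideanSpace.basisFun (Fin 3) ℝ).toBasis, Matrix.det_fin_three]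
  simp [LinearMap.toMatrix_apply, det3]
  ring

lemma euc3_eq_sum (x : Euc 3) : x = x 0 • EuclideanSpace.single 0 1 +
    x 1 • EuclideanSpace.single 1 1 + x 2 • EuclideanSpace.single 2 1 := by
  ext i
  fin_cases i <;> simp

lemma IsCoveringLattice.coversBy {T : Euc 3 →ₗ[ℝ] Euc 3} {K : Set (Euc 3)} {r : ℝ}
    (hT : IsCoveringLattice T K) (hK : K ⊆ Metric.closedBall 0 r) :
    CoversBy (T (EuclideanSpace.single 0 1)) (T (EuclideanSpace.single 1 1))
      (T (EuclideanSpace.single 2 1)) r := by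
  intro p
  have hp : p ∈ ⋃ l ∈ T '' intPoints 3, (l +ᵥ K) := hT ▸ Set.mem_univ p
  simp only [Set.mem_iUnion, Set.mem_vadd_set] at hp
  obtain ⟨_, ⟨t, ht, rfl⟩, y, hy, rfl⟩ := hp
  obtain ⟨m, hm⟩ := ht 0
  obtain ⟨n, hn⟩ := ht 1
  obtain ⟨k, hk⟩ := ht 2
  refine ⟨m, n, k, ?_⟩
  rw [← hm, ← hn, ← hk, ← map_smul, ← map_smul, ← map_smul, ← map_add, ← map_add,
    ← euc3_eq_sum, vadd_eq_add, add_sub_cancel_left]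
  simpa using hK hy

lemma det_sq_le_of_isCoveringLattice {T : Euc 3 →ₗ[ℝ] Euc 3} {K : Set (Euc 3)} {r : ℝ}
    (hT : IsCoveringLattice T K) (hK : K ⊆ Metric.closedBall 0 r) :
    4 * |LinearMap.det T| ^ 2 ≤ (16 * r ^ 2 / 5) ^ 3 := by
  rw [det_eq_det3, sq_abs]
  exact det3_sq_le_of_covers (hT.coversBy hK)

lemma critCoveringDet_unitBall_le {d : ℝ} (hd : 0 ≤ d) (h : (16 / 5) ^ 3 ≤ 4 * d ^ 2) :
    critCoveringDet (unitBall 3) ≤ d := by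
  refine Real.sSup_le ?_ hd
  rintro _ ⟨T, -, hT, rfl⟩
  have := det_sq_le_of_isCoveringLattice hT subset_rfl
  refine le_of_sq_le_sq ?_ hd
  norm_num at this h ⊢
  linarith

lemma le_critCoveringDet {K : Set (Euc 3)} (hK : Bornology.IsBounded K)
    {T : Euc 3 →ₗ[ℝ] Euc 3} (hdet : LinearMap.det T ≠ 0) (hT : IsCoveringLattice T K) :
    |LinearMap.det T| ≤ critCoveringDet K := by
  obtain ⟨r, hr⟩ := hK.subset_closedBall 0
  refine le_csSup ⟨√((16 * r ^ 2 / 5) ^ 3), ?_⟩ ⟨T, hdet, hT, rfl⟩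
  rintro _ ⟨S, -, hS, rfl⟩
  refine Real.le_sqrt_of_sq_le ?_
  linarith [det_sq_le_of_isCoveringLattice hS hr, sq_nonneg |LinearMap.det S|]

/-- The power of a point of the simplex `0, a, a + b, a + b + c` with respect to its circumscribed
sphere bounds the squared distance to the nearest vertex. -/
lemma exists_vertex_dist_sq_le {a b c z : Euc 3} {s t u : ℝ} (hs : s ≤ 1) (hts : t ≤ s)
    (hut : u ≤ t) (hu : 0 ≤ u) (ha : ‖a‖ ^ 2 = 2 * inner ℝ z a)
    (hb : ‖a + b‖ ^ 2 = 2 * inner ℝ z (a + b))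
    (hc : ‖a + b + c‖ ^ 2 = 2 * inner ℝ z (a + b + c)) :
    ∃ m n k : ℤ, ‖s • a + t • b + u • c - ((m : ℝ) • a + (n : ℝ) • b + (k : ℝ) • c)‖ ^ 2 ≤
      ‖z‖ ^ 2 - ‖s • a + t • b + u • c - z‖ ^ 2 := by
  set x := s • a + t • b + u • c with hx
  set D := ‖z‖ ^ 2 - ‖x - z‖ ^ 2 with hD
  have average : (1 - s) * (‖x‖ ^ 2 - D) + (s - t) * (‖x - a‖ ^ 2 - D) +
      (t - u) * (‖x - (a + b)‖ ^ 2 - D) + u * (‖x - (a + b + c)‖ ^ 2 - D) = 0 := by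
    simp only [hD, hx, norm_sq_euc3, inner_euc3, PiLp.add_apply, PiLp.sub_apply, PiLp.smul_apply,
      smul_eq_mul] at ha hb hc ⊢
    linear_combination (s - t) * ha + (t - u) * hb + u * hc
  by_contra! h
  have h0 := h 0 0 0
  have h1 := h 1 0 0
  have h2 := h 1 1 0
  have h3 := h 1 1 1
  simp only [Int.cast_zero, Int.cast_one, zero_smul, one_smul, add_zero, sub_zero] at h0 h1 h2 h3
  obtain ⟨μ, hμ, g0, g1, g2, g3⟩ : ∃ μ : ℝ, 0 < μ ∧ μ ≤ ‖x‖ ^ 2 - D ∧ μ ≤ ‖x - a‖ ^ 2 - D ∧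
      μ ≤ ‖x - (a + b)‖ ^ 2 - D ∧ μ ≤ ‖x - (a + b + c)‖ ^ 2 - D :=
    ⟨min (min (‖x‖ ^ 2 - D) (‖x - a‖ ^ 2 - D))
      (min (‖x - (a + b)‖ ^ 2 - D) (‖x - (a + b + c)‖ ^ 2 - D)), by simp [h0, h1, h2, h3],
      by simp, by simp, by simp, by simp⟩
  have := mul_le_mul_of_nonneg_left g0 (sub_nonneg.2 hs)
  have := mul_le_mul_of_nonneg_left g1 (sub_nonneg.2 hts)
  have := mul_le_mul_of_nonneg_left g2 (sub_nonneg.2 hut)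
  have := mul_le_mul_of_nonneg_left g3 hu
  linarith

/-- The vectors `±(x, y, x)` with an even number of sign changes generate an almost cubic
body-centred lattice. If all but one pair of its Delaunay cells have circumradius at most `1`, the
exceptional pair is covered with the help of small balls about the points `±e`. -/
lemma exists_sub_mem_caps {x y δ : ℝ} (hx : 0 < x) (hy : 0 < y)
    (hxy : 4 * x ^ 4 + y ^ 4 ≤ 4 * x ^ 2) {e : Euc 3} (hδ : 0 ≤ δ)
    (he : 2 * (x ^ 2 + y ^ 2 / 4 - 1) + 2 * ‖!₂[0, -y / 2, -x] - e‖ ^ 2 ≤ δ ^ 2)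
    {s t u : ℝ} (hs : s ∈ Set.Icc 0 1) (ht : t ∈ Set.Icc 0 1) (hu : u ∈ Set.Icc 0 1) :
    ∃ m n k : ℤ, s • !₂[x, -y, -x] + t • !₂[-x, y, -x] + u • !₂[-x, -y, x] -
      ((m : ℝ) • !₂[x, -y, -x] + (n : ℝ) • !₂[-x, y, -x] + (k : ℝ) • !₂[-x, -y, x]) ∈
      Metric.closedBall (0 : Euc 3) 1 ∪ (Metric.closedBall e δ ∪ Metric.closedBall (-e) δ) := by
  set a : Euc 3 := !₂[x, -y, -x] with ha
  set b : Euc 3 := !₂[-x, y, -x] with hb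
  set c : Euc 3 := !₂[-x, -y, x] with hc
  set G : Set (Euc 3) :=
    Metric.closedBall (0 : Euc 3) 1 ∪ (Metric.closedBall e δ ∪ Metric.closedBall (-e) δ) with hG
  have hneg : ∀ v ∈ G, -v ∈ G := by
    rintro v (h | h | h)
    · left
      simpa using h
    · right; right
      rw [mem_closedBall_iff_norm] at h ⊢
      rwa [← neg_sub', norm_neg]
    · right; left
      rw [mem_closedBall_iff_norm] at h ⊢
      rwa [← norm_neg, neg_sub, sub_neg_eq_add, add_comm, ← sub_neg_eq_add]
  have hball : ∀ v : Euc 3, ‖v‖ ^ 2 ≤ 1 → v ∈ G := fun v hv ↦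
    Or.inl (by simpa using (sq_le_one_iff₀ (norm_nonneg v)).1 hv)
  -- the two regular classes, and the exceptional one, up to central symmetry
  have bac : ∀ {s t u : ℝ}, t ≤ 1 → s ≤ t → u ≤ s → 0 ≤ u → ∃ m n k : ℤ,
      s • a + t • b + u • c - ((m : ℝ) • a + (n : ℝ) • b + (k : ℝ) • c) ∈ G := by
    intro s t u h1 h2 h3 h4
    obtain ⟨m, n, k, h⟩ := exists_vertex_dist_sq_le (a := b) (b := a) (c := c)
      (z := !₂[-y ^ 2 / (2 * x), 0, -x]) h1 h2 h3 h4
      (by simp [norm_sq_euc3, inner_euc3, hb]; field_simp; ring)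
      (by simp [norm_sq_euc3, inner_euc3, ha, hb]; field_simp; ring)
      (by simp [norm_sq_euc3, inner_euc3, ha, hb, hc]; field_simp; ring)
    refine ⟨n, m, k, hball _ ?_⟩
    have hz : ‖(!₂[-y ^ 2 / (2 * x), 0, -x] : Euc 3)‖ ^ 2 ≤ 1 := by
      have : ‖(!₂[-y ^ 2 / (2 * x), 0, -x] : Euc 3)‖ ^ 2 = (4 * x ^ 4 + y ^ 4) / (4 * x ^ 2) := by
        simp [norm_sq_euc3]
        field_simp
        ring
      rw [this]
      exact div_le_one_of_le₀ hxy (by positivity)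
    rw [add_comm (s • a), add_comm ((n : ℝ) • a)]
    linarith [sq_nonneg ‖t • b + s • a + u • c - !₂[-y ^ 2 / (2 * x), 0, -x]‖]
  have acb : ∀ {s t u : ℝ}, s ≤ 1 → u ≤ s → t ≤ u → 0 ≤ t → ∃ m n k : ℤ,
      s • a + t • b + u • c - ((m : ℝ) • a + (n : ℝ) • b + (k : ℝ) • c) ∈ G := by
    intro s t u h1 h2 h3 h4
    obtain ⟨m, n, k, h⟩ := exists_vertex_dist_sq_le (a := a) (b := c) (c := b)
      (z := !₂[0, -y, (y ^ 2 - 2 * x ^ 2) / (2 * x)]) h1 h2 h3 h4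
      (by simp [norm_sq_euc3, inner_euc3, ha]; field_simp; ring)
      (by simp [norm_sq_euc3, inner_euc3, ha, hc]; field_simp; ring)
      (by simp [norm_sq_euc3, inner_euc3, ha, hb, hc]; field_simp; ring)
    refine ⟨m, k, n, hball _ ?_⟩
    have hz : ‖(!₂[0, -y, (y ^ 2 - 2 * x ^ 2) / (2 * x)] : Euc 3)‖ ^ 2 ≤ 1 := by
      have : ‖(!₂[0, -y, (y ^ 2 - 2 * x ^ 2) / (2 * x)] : Euc 3)‖ ^ 2 =
          (4 * x ^ 4 + y ^ 4) / (4 * x ^ 2) := by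
        simp [norm_sq_euc3]
        field_simp
        ring
      rw [this]
      exact div_le_one_of_le₀ hxy (by positivity)
    rw [add_right_comm (s • a), add_right_comm ((m : ℝ) • a)]
    linarith [sq_nonneg ‖s • a + u • c + t • b - !₂[0, -y, (y ^ 2 - 2 * x ^ 2) / (2 * x)]‖]
  have abc : ∀ {s t u : ℝ}, s ≤ 1 → t ≤ s → u ≤ t → 0 ≤ u → ∃ m n k : ℤ,
      s • a + t • b + u • c - ((m : ℝ) • a + (n : ℝ) • b + (k : ℝ) • c) ∈ G := by
    intro s t u h1 h2 h3 h4
    obtain ⟨m, n, k, h⟩ := exists_vertex_dist_sq_le (a := a) (b := b) (c := c)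
      (z := !₂[0, -y / 2, -x]) h1 h2 h3 h4
      (by simp [norm_sq_euc3, inner_euc3, ha]; field_simp; ring)
      (by simp [norm_sq_euc3, inner_euc3, ha, hb]; field_simp; ring)
      (by simp [norm_sq_euc3, inner_euc3, ha, hb, hc]; field_simp; ring)
    set z : Euc 3 := !₂[0, -y / 2, -x] with hz
    set v := s • a + t • b + u • c with hv
    have hzn : ‖z‖ ^ 2 = x ^ 2 + y ^ 2 / 4 := by
      simp [norm_sq_euc3, hz]
      ring
    by_cases hfar : ‖z‖ ^ 2 - ‖v - z‖ ^ 2 ≤ 1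
    · exact ⟨m, n, k, hball _ (h.trans hfar)⟩
    · refine ⟨0, 0, 0, Or.inr (Or.inl ?_)⟩
      rw [mem_closedBall_iff_norm]
      refine le_of_sq_le_sq ?_ hδ
      have htri : ‖v - e‖ ^ 2 ≤ 2 * ‖v - z‖ ^ 2 + 2 * ‖z - e‖ ^ 2 := by
        have := parallelogram_law_with_norm ℝ (v - z) (z - e)
        rw [sub_add_sub_cancel] at this
        nlinarith [sq_nonneg ‖v - z - (z - e)‖]
      simp only [Int.cast_zero, zero_smul, add_zero, sub_zero]
      linarith
  have symm : ∀ {s t u : ℝ}, (∃ m n k : ℤ, (1 - s) • a + (1 - t) • b + (1 - u) • c -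
      ((m : ℝ) • a + (n : ℝ) • b + (k : ℝ) • c) ∈ G) → ∃ m n k : ℤ,
      s • a + t • b + u • c - ((m : ℝ) • a + (n : ℝ) • b + (k : ℝ) • c) ∈ G := by
    rintro s t u ⟨m, n, k, h⟩
    refine ⟨1 - m, 1 - n, 1 - k, ?_⟩
    convert hneg _ h using 1
    push_cast
    module
  obtain ⟨hs0, hs1⟩ := hs
  obtain ⟨ht0, ht1⟩ := ht
  obtain ⟨hu0, hu1⟩ := hu
  rcases le_total s t with h1 | h1 <;> rcases le_total t u with h2 | h2 <;>
    rcases le_total s u with h3 | h3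
  · exact symm (abc (by linarith) (by linarith) (by linarith) (by linarith))
  · exact symm (abc (by linarith) (by linarith) (by linarith) (by linarith))
  · exact symm (acb (by linarith) (by linarith) (by linarith) (by linarith))
  · exact bac ht1 h1 h3 hu0
  · exact symm (bac (by linarith) (by linarith) (by linarith) (by linarith))
  · exact acb hs1 h3 h2 ht0
  · exact abc hs1 h1 h2 hu0
  · exact abc hs1 h1 h2 hu0

/-- The linear map with prescribed images of the standard basis of `ℝ³`. -/
def ofColumns (a b c : Euc 3) : Euc 3 →ₗ[ℝ] Euc 3 where
  toFun t := t 0 • a + t 1 • b + t 2 • c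
  map_add' s t := by
    simp only [PiLp.add_apply]
    module
  map_smul' k t := by
    simp only [PiLp.smul_apply, smul_eq_mul, RingHom.id_apply]
    module

lemma det_ofColumns (a b c : Euc 3) : LinearMap.det (ofColumns a b c) = det3 a b c := by
  simp [det_eq_det3, ofColumns]

lemma isCoveringLattice_comp_ofColumns {a b c : Euc 3} {K : Set (Euc 3)} (φ : Euc 3 ≃ₗᵢ[ℝ] Euc 3)
    (hdet : det3 a b c ≠ 0)
    (h : ∀ s ∈ Set.Icc (0 : ℝ) 1, ∀ t ∈ Set.Icc (0 : ℝ) 1, ∀ u ∈ Set.Icc (0 : ℝ) 1,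
      ∃ m n k : ℤ, φ (s • a + t • b + u • c -
        ((m : ℝ) • a + (n : ℝ) • b + (k : ℝ) • c)) ∈ K) :
    IsCoveringLattice (φ.toLinearEquiv.toLinearMap ∘ₗ ofColumns a b c) K := by
  refine Set.eq_univ_of_forall fun p ↦ ?_
  obtain ⟨q, hq⟩ : ∃ q, ofColumns a b c q = φ.symm p :=
    ((ofColumns a b c).equivOfDetNeZero (by rwa [det_ofColumns])).surjective _
  have mem : ∀ j : Fin 3, Int.fract (q j) ∈ Set.Icc (0 : ℝ) 1 := fun j ↦
    ⟨Int.fract_nonneg _, (Int.fract_lt_one _).le⟩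
  obtain ⟨m, n, k, hK⟩ := h _ (mem 0) _ (mem 1) _ (mem 2)
  simp only [Set.mem_iUnion, Set.mem_vadd_set]
  refine ⟨_, ⟨!₂[(⌊q 0⌋ + m : ℝ), (⌊q 1⌋ + n : ℝ), (⌊q 2⌋ + k : ℝ)], ?_, rfl⟩, _, hK, ?_⟩
  · intro i
    fin_cases i
    · exact ⟨⌊q 0⌋ + m, by simp⟩
    · exact ⟨⌊q 1⌋ + n, by simp⟩
    · exact ⟨⌊q 2⌋ + k, by simp⟩
  · simp only [vadd_eq_add, LinearMap.comp_apply, LinearEquiv.coe_coe,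
      LinearIsometryEquiv.coe_toLinearEquiv]
    rw [← map_add, ← φ.apply_symm_apply p, ← hq]
    congr 1
    simp only [ofColumns, LinearMap.coe_mk, AddHom.coe_mk, ← Int.self_sub_floor,
      Matrix.cons_val_zero, Matrix.cons_val_one, Matrix.cons_val]
    module

/-- A convex body containing the unit ball and a point outside it contains a ball about some point
of the unit sphere. -/
lemma exists_cap {K : Set (Euc 3)} (hconv : Convex ℝ K) (hB : unitBall 3 ⊂ K) :
    ∃ e : Euc 3, ‖e‖ = 1 ∧ ∃ δ > 0, Metric.closedBall e δ ⊆ K := by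
  obtain ⟨hsub, p, hp, hpB⟩ := Set.ssubset_iff_exists.1 hB
  have hp1 : 1 < ‖p‖ := by simpa [unitBall] using hpB
  have hp0 : 0 < ‖p‖ := one_pos.trans hp1
  have hθ : 0 < 1 - ‖p‖⁻¹ := sub_pos.2 (inv_lt_one_of_one_lt₀ hp1)
  refine ⟨‖p‖⁻¹ • p, by rw [norm_smul, norm_inv, norm_norm, inv_mul_cancel₀ hp0.ne'],
    1 - ‖p‖⁻¹, hθ, fun x hx ↦ ?_⟩
  rw [mem_closedBall_iff_norm] at hx
  have hz : (1 - ‖p‖⁻¹)⁻¹ • (x - ‖p‖⁻¹ • p) ∈ K := by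
    refine hsub (mem_closedBall_zero_iff.2 ?_)
    rw [norm_smul, norm_inv, Real.norm_of_nonneg hθ.le]
    exact inv_mul_le_one_of_le₀ hx hθ.le
  have := hconv hp hz (inv_nonneg.2 hp0.le) hθ.le (by ring)
  rwa [smul_inv_smul₀ hθ.ne', add_sub_cancel] at this

/-- The ball `B³` is inextensible: every origin-symmetric convex body properly containing
`B³` has strictly larger critical covering determinant. -/
theorem ball3_inextensible (K : Set (Euc 3)) (hK : IsSymmConvexBody K)
    (hKB : unitBall 3 ⊂ K) :
    critCoveringDet (unitBall 3) < critCoveringDet K := by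
  obtain ⟨hcomp, hconv, -, hsymm⟩ := hK
  obtain ⟨e, he, δ, hδ, hcap⟩ := exists_cap hconv hKB
  set r : ℝ := √(4 / 5) with hr
  have hr0 : 0 < r := by positivity
  have hr2 : r ^ 2 = 4 / 5 := Real.sq_sqrt (by norm_num)
  have hr4 : r ^ 4 = 16 / 25 := by rw [show r ^ 4 = (r ^ 2) ^ 2 by ring, hr2]; norm_num
  set e₀ : Euc 3 := !₂[0, -r / 2, -r] with he₀
  have he₀n : ‖e₀‖ = 1 := by
    have : ‖e₀‖ ^ 2 = 1 := by
      simp [norm_sq_euc3, he₀]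
      linarith
    exact (pow_eq_one_iff_of_nonneg (norm_nonneg _) two_ne_zero).1 this
  set φ : Euc 3 ≃ₗᵢ[ℝ] Euc 3 := (ℝ ∙ (e₀ - e))ᗮ.reflection with hφ
  have hφe : φ e₀ = e := Submodule.reflection_sub (he₀n.trans he.symm)
  have hφdet : |LinearMap.det φ.toLinearEquiv.toLinearMap| = 1 := by
    rw [hφ, Submodule.det_reflection, abs_pow, abs_neg, abs_one, one_pow]
  obtain ⟨ε, hε, hε1, hεδ⟩ : ∃ ε : ℝ, 0 < ε ∧ ε ≤ 1 / 200 ∧ 7 * ε ≤ δ ^ 2 :=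
    ⟨min (1 / 200) (δ ^ 2 / 7), by positivity, min_le_left _ _, by
      linarith [min_le_right (1 / 200) (δ ^ 2 / 7)]⟩
  set x := r * (1 + 3 * ε) with hx
  set y := r * (1 - 5 * ε) with hy
  have hx0 : 0 < x := by positivity
  have hy0 : 0 < y := mul_pos hr0 (by linarith)
  have hxy : 4 * x ^ 4 + y ^ 4 ≤ 4 * x ^ 2 := by
    simp only [hx, hy, mul_pow, hr2, hr4]
    nlinarith [pow_pos hε 2, pow_pos hε 3, mul_le_mul_of_nonneg_left hε1 hε.le,
      mul_le_mul_of_nonneg_left hε1 (pow_pos hε 2).le,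
      mul_le_mul_of_nonneg_left hε1 (pow_pos hε 3).le]
  have hcapx : 2 * (x ^ 2 + y ^ 2 / 4 - 1) + 2 * ‖!₂[0, -y / 2, -x] - e₀‖ ^ 2 ≤ δ ^ 2 := by
    have : ‖!₂[0, -y / 2, -x] - e₀‖ ^ 2 = r ^ 2 * (61 / 4 * ε ^ 2) := by
      simp [norm_sq_euc3, he₀, hx, hy]
      ring
    rw [this]
    simp only [hx, hy, mul_pow, hr2]
    nlinarith [mul_le_mul_of_nonneg_left hε1 hε.le]
  have hdet : det3 !₂[x, -y, -x] !₂[-x, y, -x] !₂[-x, -y, x] = -(4 * (x ^ 2 * y)) := by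
    simp [det3]
    ring
  set T := φ.toLinearEquiv.toLinearMap ∘ₗ ofColumns !₂[x, -y, -x] !₂[-x, y, -x] !₂[-x, -y, x]
    with hT
  have hTdet : |LinearMap.det T| = 4 * (x ^ 2 * y) := by
    rw [hT, LinearMap.det_comp, abs_mul, hφdet, one_mul, det_ofColumns, hdet, abs_neg,
      abs_of_pos (by positivity)]
  have hcover : IsCoveringLattice T K := by
    refine isCoveringLattice_comp_ofColumns φ (by rw [hdet]; exact neg_ne_zero.2 (by positivity))
      fun s hs t ht u hu ↦ ?_
    obtain ⟨m, n, k, h⟩ := exists_sub_mem_caps hx0 hy0 hxy hδ.le hcapx hs ht hu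
    refine ⟨m, n, k, ?_⟩
    rcases h with h | h | h
    · refine hKB.subset (mem_closedBall_zero_iff.2 ?_)
      rw [φ.norm_map]
      exact mem_closedBall_zero_iff.1 h
    · refine hcap ?_
      rw [mem_closedBall_iff_norm, ← hφe, ← map_sub, φ.norm_map]
      exact mem_closedBall_iff_norm.1 h
    · rw [hsymm]
      refine hcap ?_
      rw [mem_closedBall_iff_norm, ← hφe, ← map_neg, ← map_sub, φ.norm_map, ← norm_neg, neg_sub,
        sub_neg_eq_add, add_comm, ← sub_neg_eq_add]
      exact mem_closedBall_iff_norm.1 h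
  have hle := le_critCoveringDet hcomp.isBounded
    (by rw [← abs_pos, hTdet]; positivity) hcover
  have hball : critCoveringDet (unitBall 3) ≤ 4 * r ^ 3 := by
    refine critCoveringDet_unitBall_le (by positivity) (le_of_eq ?_)
    rw [show 4 * (4 * r ^ 3) ^ 2 = 64 * (r ^ 2) ^ 3 by ring, hr2]
    norm_num
  refine hball.trans_lt (lt_of_lt_of_le ?_ (hTdet ▸ hle))
  have hvol : 1 < (1 + 3 * ε) ^ 2 * (1 - 5 * ε) := by
    nlinarith [mul_le_mul_of_nonneg_left hε1 hε.le,
      mul_le_mul_of_nonneg_left hε1 (pow_pos hε 2).le]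
  have hr3 : 0 < r ^ 3 := by positivity
  calc 4 * r ^ 3 < 4 * r ^ 3 * ((1 + 3 * ε) ^ 2 * (1 - 5 * ε)) :=
        lt_mul_of_one_lt_right (by positivity) hvol
    _ = 4 * (x ^ 2 * y) := by rw [hx, hy]; ring
end
end

section
/- The disk B² is inextensible: every origin-symmetric convex body K in ℝ² that properly contains B² satisfies d_K > d_{B²}, where d_K is the critical covering determinant of K. -/
open Set Pointwise MeasureTheory

noncomputable section

/-- Gauss reduction of a positively oriented pair of plane vectors. -/
lemma exists_reduced_pair_of_det_pos (u₀ u₁ w₀ w₁ : ℝ) (hD : 0 < u₀ * w₁ - u₁ * w₀) :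
    ∃ p q r s : ℤ, p * s - q * r = 1 ∧ ∃ a₀ a₁ b₀ b₁ : ℝ,
      a₀ = p * u₀ + q * w₀ ∧ a₁ = p * u₁ + q * w₁ ∧
      b₀ = r * u₀ + s * w₀ ∧ b₁ = r * u₁ + s * w₁ ∧
      2 * |a₀ * b₀ + a₁ * b₁| ≤ a₀ ^ 2 + a₁ ^ 2 ∧ a₀ ^ 2 + a₁ ^ 2 ≤ b₀ ^ 2 + b₁ ^ 2 := by
  have hA : 0 < u₀ ^ 2 + u₁ ^ 2 := by
    by_contra! h
    have h0 : u₀ = 0 := by nlinarith [sq_nonneg u₀, sq_nonneg u₁]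
    have h1 : u₁ = 0 := by nlinarith [sq_nonneg u₀, sq_nonneg u₁]
    simp [h0, h1] at hD
  set u : ℂ := ⟨u₀, u₁⟩ with hu
  set w : ℂ := ⟨w₀, w₁⟩ with hw
  have hu0 : u ≠ 0 := by
    intro h
    have h0 : u₀ = 0 := congrArg Complex.re h
    have h1 : u₁ = 0 := congrArg Complex.im h
    simp [h0, h1] at hA
  have him : 0 < (w / u).im := by
    have : (w / u).im = (u₀ * w₁ - u₁ * w₀) / (u₀ ^ 2 + u₁ ^ 2) := by
      simp only [Complex.div_im, Complex.normSq_apply, hu, hw]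
      field_simp
    rw [this]
    positivity
  obtain ⟨g, hg⟩ := ModularGroup.exists_smul_mem_fd ⟨w / u, him⟩
  obtain ⟨h1, h2⟩ := hg
  set z : UpperHalfPlane := g • (⟨w / u, him⟩ : UpperHalfPlane) with hz
  have hdet := Matrix.det_fin_two g.1
  rw [g.2] at hdet
  have hden := UpperHalfPlane.denom_ne_zero g ⟨w / u, him⟩
  have hzc : (z : ℂ) * ((g 1 0 : ℂ) * w + (g 1 1 : ℂ) * u)
      = (g 0 0 : ℂ) * w + (g 0 1 : ℂ) * u := by
    rw [hz, UpperHalfPlane.specialLinearGroup_apply]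
    have hne : w * (g 1 0 : ℂ) + u * (g 1 1 : ℂ) ≠ 0 := by
      intro h
      apply hden
      simp only [UpperHalfPlane.denom]
      simp
      field_simp
      linear_combination h
    simp
    field_simp
  set x := z.re
  set y := z.im
  have hzxy : (z : ℂ) = ⟨x, y⟩ := rfl
  rw [hzxy] at hzc
  have hre := congrArg Complex.re hzc
  have him' := congrArg Complex.im hzc
  simp [hu, hw] at hre him'
  have hns : 1 ≤ x ^ 2 + y ^ 2 := by
    have := h1
    rw [hzxy, Complex.normSq_apply] at this
    nlinarith
  refine ⟨g 1 1, g 1 0, g 0 1, g 0 0, by linarith, _, _, _, _, rfl, rfl, rfl, rfl, ?_, ?_⟩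
  all_goals
    set a₀ : ℝ := (g 1 1 : ℤ) * u₀ + (g 1 0 : ℤ) * w₀ with ha0
    set a₁ : ℝ := (g 1 1 : ℤ) * u₁ + (g 1 0 : ℤ) * w₁ with ha1
    have hb0 : (g 0 1 : ℤ) * u₀ + (g 0 0 : ℤ) * w₀ = x * a₀ - y * a₁ := by
      rw [ha0, ha1]; linarith
    have hb1 : (g 0 1 : ℤ) * u₁ + (g 0 0 : ℤ) * w₁ = x * a₁ + y * a₀ := by
      rw [ha0, ha1]; linarith
    rw [hb0, hb1]
  · have : a₀ * (x * a₀ - y * a₁) + a₁ * (x * a₁ + y * a₀) = x * (a₀ ^ 2 + a₁ ^ 2) := by ring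
    rw [this, abs_mul, abs_of_nonneg (by positivity : 0 ≤ a₀ ^ 2 + a₁ ^ 2)]
    have h2' : |x| ≤ 1 / 2 := h2
    nlinarith [sq_nonneg a₀, sq_nonneg a₁]
  · have : (x * a₀ - y * a₁) ^ 2 + (x * a₁ + y * a₀) ^ 2
        = (x ^ 2 + y ^ 2) * (a₀ ^ 2 + a₁ ^ 2) := by ring
    rw [this]
    nlinarith [sq_nonneg a₀, sq_nonneg a₁]

/-- Gauss reduction: every plane lattice has a basis spanning a non-obtuse triangle whose
shortest side is the first basis vector. -/
lemma exists_reduced_pair (u₀ u₁ w₀ w₁ : ℝ) (hD : u₀ * w₁ - u₁ * w₀ ≠ 0) :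
    ∃ p q r s : ℤ, (p * s - q * r) ^ 2 = 1 ∧ ∃ a₀ a₁ b₀ b₁ : ℝ,
      a₀ = p * u₀ + q * w₀ ∧ a₁ = p * u₁ + q * w₁ ∧
      b₀ = r * u₀ + s * w₀ ∧ b₁ = r * u₁ + s * w₁ ∧
      0 ≤ a₀ * b₀ + a₁ * b₁ ∧
      2 * (a₀ * b₀ + a₁ * b₁) ≤ a₀ ^ 2 + a₁ ^ 2 ∧ a₀ ^ 2 + a₁ ^ 2 ≤ b₀ ^ 2 + b₁ ^ 2 := by
  have key : ∃ p q r s : ℤ, (p * s - q * r) ^ 2 = 1 ∧ ∃ a₀ a₁ b₀ b₁ : ℝ,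
      a₀ = p * u₀ + q * w₀ ∧ a₁ = p * u₁ + q * w₁ ∧
      b₀ = r * u₀ + s * w₀ ∧ b₁ = r * u₁ + s * w₁ ∧
      2 * |a₀ * b₀ + a₁ * b₁| ≤ a₀ ^ 2 + a₁ ^ 2 ∧ a₀ ^ 2 + a₁ ^ 2 ≤ b₀ ^ 2 + b₁ ^ 2 := by
    rcases lt_or_gt_of_ne hD with h | h
    · obtain ⟨p, q, r, s, h1, a₀, a₁, b₀, b₁, e1, e2, e3, e4, h2, h3⟩ :=
        exists_reduced_pair_of_det_pos u₀ u₁ (-w₀) (-w₁) (by linarith)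
      refine ⟨p, -q, r, -s, by linear_combination (p * s - q * r + 1) * h1,
        a₀, a₁, b₀, b₁, ?_, ?_, ?_, ?_, h2, h3⟩ <;> push_cast <;> linarith
    · obtain ⟨p, q, r, s, h1, rest⟩ := exists_reduced_pair_of_det_pos u₀ u₁ w₀ w₁ h
      exact ⟨p, q, r, s, by rw [h1]; rfl, rest⟩
  obtain ⟨p, q, r, s, h1, a₀, a₁, b₀, b₁, e1, e2, e3, e4, h2, h3⟩ := key
  rcases le_total 0 (a₀ * b₀ + a₁ * b₁) with h | h
  · exact ⟨p, q, r, s, h1, a₀, a₁, b₀, b₁, e1, e2, e3, e4, h,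
      by rwa [abs_of_nonneg h] at h2, h3⟩
  · rw [abs_of_nonpos h] at h2
    refine ⟨p, q, -r, -s, by linear_combination h1, a₀, a₁, -b₀, -b₁, e1, e2, ?_, ?_,
      by linarith, by linarith, by linarith⟩ <;> push_cast <;> linarith

/-- The circumcentre of a reduced triangle is at least as close to the origin as to any other
lattice point. -/
lemma reduced_form_nonneg {A B C : ℝ} (hB : 0 ≤ B) (hBA : 2 * B ≤ A) (hAC : A ≤ C) (m n : ℤ) :
    0 ≤ A * (m * (m - 1)) + C * (n * (n - 1)) + 2 * B * (m * n) := by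
  have hint : ∀ k : ℤ, (0 : ℝ) ≤ k * (k - 1) := by
    intro k
    have : 0 ≤ k * (k - 1) := by
      rcases le_or_gt k 0 with h | h <;> nlinarith
    exact_mod_cast this
  have hA : 0 ≤ A := by linarith
  have hC : A * (n * (n - 1) : ℝ) ≤ C * (n * (n - 1)) :=
    mul_le_mul_of_nonneg_right hAC (hint n)
  rcases le_or_gt 0 ((m : ℝ) * n) with h | h
  · have := mul_nonneg hA (hint m)
    have := mul_nonneg hA (hint n)
    have := mul_nonneg hB h
    linarith
  · have h1 : A * ((m : ℝ) * n) ≤ 2 * B * (m * n) :=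
      mul_le_mul_of_nonpos_right hBA h.le
    have h2 := hint (m + n)
    push_cast at h2
    have h3 : 0 ≤ A * ((m + n) * ((m + n : ℝ) - 1) - m * n) :=
      mul_nonneg hA (by linarith)
    linarith

/-- Among triangles with given circumradius the equilateral one has largest area, where
`A`, `C` are two squared side lengths and `B` is the inner product of these sides. -/
lemma gram_cube_le {A B C : ℝ} (hA : 0 < A) (hC : 0 < C) (hB : 0 ≤ B) (hBA : 2 * B ≤ A)
    (hAC : A ≤ C) :
    64 * (A * C - B ^ 2) ^ 3 ≤ 27 * (A * C * (A + C - 2 * B)) ^ 2 := by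
  obtain ⟨g, hg0, hg⟩ : ∃ g : ℝ, 0 ≤ g ∧ g ^ 2 = A * C :=
    ⟨√(A * C), Real.sqrt_nonneg _, Real.sq_sqrt (by positivity)⟩
  have hgA : A ≤ g := by
    refine (sq_le_sq₀ (by positivity) hg0).1 ?_
    nlinarith
  have hE : 2 * g ≤ A + C := by
    apply abs_le_of_sq_le_sq' _ (by linarith) |>.2
    nlinarith [sq_nonneg (A - C)]
  have hgB : 0 ≤ g - B := by linarith
  have hE2 : (2 * (g - B)) ^ 2 ≤ (A + C - 2 * B) ^ 2 := by
    apply pow_le_pow_left₀ <;> linarith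
  have hquart : 16 * ((g - B) * (g + B) ^ 3) ≤ 27 * g ^ 4 := by
    have : 27 * g ^ 4 - 16 * ((g - B) * (g + B) ^ 3)
        = (g - 2 * B) ^ 2 * (11 * g ^ 2 + 12 * g * B + 4 * B ^ 2) := by ring
    have : 0 ≤ (g - 2 * B) ^ 2 * (11 * g ^ 2 + 12 * g * B + 4 * B ^ 2) := by positivity
    linarith
  calc 64 * (A * C - B ^ 2) ^ 3
      = 4 * (g - B) ^ 2 * (16 * ((g - B) * (g + B) ^ 3)) := by rw [← hg]; ring
    _ ≤ 4 * (g - B) ^ 2 * (27 * g ^ 4) := by gcongr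
    _ = 27 * g ^ 4 * (2 * (g - B)) ^ 2 := by ring
    _ ≤ 27 * g ^ 4 * (A + C - 2 * B) ^ 2 := by gcongr
    _ = 27 * (A * C * (A + C - 2 * B)) ^ 2 := by
      rw [mul_pow, ← hg]; ring

/-- A plane lattice of covering radius at most `R` has determinant at most `3√3/2 * R ^ 2`. -/
lemma abs_det_le_of_covering {u₀ u₁ w₀ w₁ R : ℝ}
    (hcov : ∀ x y : ℝ, ∃ m n : ℤ,
      (x - (m * u₀ + n * w₀)) ^ 2 + (y - (m * u₁ + n * w₁)) ^ 2 ≤ R ^ 2) :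
    |u₀ * w₁ - u₁ * w₀| ≤ 3 * √3 / 2 * R ^ 2 := by
  by_cases hD : u₀ * w₁ - u₁ * w₀ = 0
  · rw [hD, abs_zero]; positivity
  obtain ⟨p, q, r, s, hpq, a₀, a₁, b₀, b₁, e1, e2, e3, e4, hB, hBA, hAC⟩ :=
    exists_reduced_pair u₀ u₁ w₀ w₁ hD
  have hpq' : ((p : ℝ) * s - q * r) ^ 2 = 1 := by exact_mod_cast hpq
  set d := a₀ * b₁ - a₁ * b₀ with hd
  have hdD : d = (p * s - q * r) * (u₀ * w₁ - u₁ * w₀) := by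
    rw [hd, e1, e2, e3, e4]; ring
  have hd2 : d ^ 2 = (u₀ * w₁ - u₁ * w₀) ^ 2 := by rw [hdD, mul_pow, hpq', one_mul]
  have hd0 : d ≠ 0 := by
    intro h
    rw [h] at hd2
    exact hD (by simpa using hd2.symm)
  set A := a₀ ^ 2 + a₁ ^ 2 with hAdef
  set B := a₀ * b₀ + a₁ * b₁ with hBdef
  set C := b₀ ^ 2 + b₁ ^ 2 with hCdef
  have hgram : d ^ 2 = A * C - B ^ 2 := by rw [hd, hAdef, hBdef, hCdef]; ring
  have hdpos : 0 < d ^ 2 := by positivity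
  have hA : 0 < A := by
    rcases (show 0 ≤ A by positivity).lt_or_eq with h | h
    · exact h
    · rw [← h] at hgram; nlinarith [sq_nonneg B]
  have hC : 0 < C := by linarith
  -- the circumcentre of the triangle `0, a, b`
  set c₀ := (A * b₁ - C * a₁) / (2 * d) with hc0
  set c₁ := (C * a₀ - A * b₀) / (2 * d) with hc1
  have hca : 2 * (c₀ * a₀ + c₁ * a₁) = A := by
    rw [hc0, hc1]; field_simp; rw [hd]; ring
  have hcb : 2 * (c₀ * b₀ + c₁ * b₁) = C := by
    rw [hc0, hc1]; field_simp; rw [hd]; ring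
  have hcc : (c₀ ^ 2 + c₁ ^ 2) * (4 * d ^ 2) = A * C * (A + C - 2 * B) := by
    rw [hc0, hc1]; field_simp; rw [hAdef, hBdef, hCdef]; ring
  obtain ⟨k, l, hkl⟩ := hcov c₀ c₁
  obtain ⟨m, n, hx, hy⟩ : ∃ m n : ℤ, (k * u₀ + l * w₀ : ℝ) = m * a₀ + n * b₀ ∧
      (k * u₁ + l * w₁ : ℝ) = m * a₁ + n * b₁ := by
    refine ⟨(p * s - q * r) * (s * k - r * l), (p * s - q * r) * (p * l - q * k), ?_, ?_⟩
    · push_cast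
      rw [e1, e3]
      linear_combination -(k * u₀ + l * w₀ : ℝ) * hpq'
    · push_cast
      rw [e2, e4]
      linear_combination -(k * u₁ + l * w₁ : ℝ) * hpq'
  rw [hx, hy] at hkl
  have hform := reduced_form_nonneg hB hBA hAC m n
  have hcR : c₀ ^ 2 + c₁ ^ 2 ≤ R ^ 2 := by
    have : (c₀ - (m * a₀ + n * b₀)) ^ 2 + (c₁ - (m * a₁ + n * b₁)) ^ 2
        = c₀ ^ 2 + c₁ ^ 2 + (A * (m * (m - 1)) + C * (n * (n - 1)) + 2 * B * (m * n)) := by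
      linear_combination -(m : ℝ) * hca - (n : ℝ) * hcb
    linarith
  have hcube := gram_cube_le hA hC hB hBA hAC
  rw [← hgram, ← hcc] at hcube
  have h4 : 4 * d ^ 2 ≤ 27 * (R ^ 2) ^ 2 := by
    have h5 : (c₀ ^ 2 + c₁ ^ 2) ^ 2 ≤ (R ^ 2) ^ 2 := by
      apply pow_le_pow_left₀ (by positivity) hcR
    have h6 : 16 * (d ^ 2) ^ 2 * (4 * d ^ 2) ≤ 16 * (d ^ 2) ^ 2 * (27 * (R ^ 2) ^ 2) := by
      calc _ = 64 * (d ^ 2) ^ 3 := by ring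
        _ ≤ _ := hcube
        _ = 16 * (d ^ 2) ^ 2 * (27 * (c₀ ^ 2 + c₁ ^ 2) ^ 2) := by ring
        _ ≤ _ := by gcongr
    exact le_of_mul_le_mul_left h6 (by positivity)
  apply abs_le_of_sq_le_sq _ (by positivity)
  rw [← hd2, mul_pow, div_pow, mul_pow, Real.sq_sqrt (by norm_num)]
  linarith

lemma isCoveringLattice_iff_exists_int (T : Euc 2 →ₗ[ℝ] Euc 2) (K : Set (Euc 2)) :
    IsCoveringLattice T K ↔ ∀ x : Euc 2, ∃ m n : ℤ,
      x - ((m : ℝ) • T !₂[1, 0] + (n : ℝ) • T !₂[0, 1]) ∈ K := by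
  simp only [IsCoveringLattice, Set.eq_univ_iff_forall, Set.mem_iUnion, exists_prop,
    Set.mem_vadd_set_iff_neg_vadd_mem, Set.exists_mem_image, vadd_eq_add]
  refine forall_congr' fun x => ⟨?_, ?_⟩
  · rintro ⟨y, hy, hx⟩
    obtain ⟨m, hm⟩ := hy 0
    obtain ⟨n, hn⟩ := hy 1
    refine ⟨m, n, ?_⟩
    have : y = (m : ℝ) • !₂[1, 0] + (n : ℝ) • !₂[0, 1] := by
      ext i; fin_cases i <;> simp [hm, hn]
    rw [this, map_add, map_smul, map_smul] at hx
    rwa [sub_eq_neg_add]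
  · rintro ⟨m, n, h⟩
    refine ⟨(m : ℝ) • !₂[1, 0] + (n : ℝ) • !₂[0, 1], ?_, ?_⟩
    · intro i
      fin_cases i
      · exact ⟨m, by simp⟩
      · exact ⟨n, by simp⟩
    · rw [map_add, map_smul, map_smul]
      rwa [sub_eq_neg_add] at h

lemma det_euc_two (T : Euc 2 →ₗ[ℝ] Euc 2) :
    LinearMap.det T
      = T !₂[1, 0] 0 * T !₂[0, 1] 1 - T !₂[1, 0] 1 * T !₂[0, 1] 0 := by
  have h0 : EuclideanSpace.single (0 : Fin 2) (1 : ℝ) = !₂[1, 0] := by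
    ext i; fin_cases i <;> simp
  have h1 : EuclideanSpace.single (1 : Fin 2) (1 : ℝ) = !₂[0, 1] := by
    ext i; fin_cases i <;> simp
  rw [← LinearMap.det_toMatrix (EuclideanSpace.basisFun (Fin 2) ℝ).toBasis, Matrix.det_fin_two]
  simp [LinearMap.toMatrix_apply, h0, h1]
  ring

lemma abs_det_le_of_subset_closedBall {K : Set (Euc 2)} {R : ℝ}
    (hKR : K ⊆ Metric.closedBall 0 R) {T : Euc 2 →ₗ[ℝ] Euc 2} (hT : IsCoveringLattice T K) :
    |LinearMap.det T| ≤ 3 * √3 / 2 * R ^ 2 := by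
  rw [isCoveringLattice_iff_exists_int] at hT
  rw [det_euc_two]
  refine abs_det_le_of_covering fun x y => ?_
  obtain ⟨m, n, h⟩ := hT !₂[x, y]
  refine ⟨m, n, ?_⟩
  have h' := mem_closedBall_zero_iff.1 (hKR h)
  have h2 := pow_le_pow_left₀ (norm_nonneg _) h' 2
  rw [EuclideanSpace.norm_sq_eq, Fin.sum_univ_two] at h2
  simpa using h2

/-- The lattice hexagon tiling with vertices `(±s, 0)`, `(±1/2, ±1/2)` in suitable coordinates. -/
lemma exists_int_hexagon {s : ℝ} (hs : 1 < s) (x y : ℝ) : ∃ m n : ℤ,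
    |y - (m / 2 + n)| ≤ 1 / 2 ∧
      |x - m * (s + 1 / 2)| + (2 * s - 1) * |y - (m / 2 + n)| ≤ s := by
  have hL : 0 < s + 1 / 2 := by linarith
  obtain ⟨m, hm0, hm1⟩ : ∃ m : ℤ, 0 ≤ x - m * (s + 1 / 2) ∧ x - m * (s + 1 / 2) ≤ s + 1 / 2 := by
    refine ⟨⌊x / (s + 1 / 2)⌋, ?_, ?_⟩
    · have := Int.floor_le (x / (s + 1 / 2))
      rw [le_div_iff₀ hL] at this
      linarith
    · have := (Int.lt_floor_add_one (x / (s + 1 / 2))).le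
      rw [div_le_iff₀ hL] at this
      linarith
  obtain ⟨n, hn⟩ : ∃ n : ℤ, |y - (m / 2 + n)| ≤ 1 / 2 :=
    ⟨round (y - m / 2), by simpa [sub_sub] using abs_sub_round (y - m / 2)⟩
  by_cases h : |x - m * (s + 1 / 2)| + (2 * s - 1) * |y - (m / 2 + n)| ≤ s
  · exact ⟨m, n, hn, h⟩
  push Not at h
  set t := x - m * (s + 1 / 2) with ht
  set v := y - (m / 2 + n) with hv
  rw [abs_of_nonneg hm0] at h
  have hx' : |x - ((m + 1 : ℤ) : ℝ) * (s + 1 / 2)| = s + 1 / 2 - t := by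
    rw [abs_of_nonpos] <;> push_cast <;> linarith
  rcases le_total 0 v with h0 | h0
  · rw [abs_of_nonneg h0] at h hn
    have hy' : |y - (((m + 1 : ℤ) : ℝ) / 2 + n)| = 1 / 2 - v := by
      rw [abs_of_nonpos] <;> push_cast <;> linarith
    refine ⟨m + 1, n, ?_, ?_⟩
    · rw [hy']; linarith
    · rw [hx', hy']; linarith
  · rw [abs_of_nonpos h0] at h hn
    have hy' : |y - (((m + 1 : ℤ) : ℝ) / 2 + ((n - 1 : ℤ) : ℝ))| = 1 / 2 + v := by
      rw [abs_of_nonneg] <;> push_cast <;> linarith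
    refine ⟨m + 1, n - 1, ?_, ?_⟩
    · rw [hy']; linarith
    · rw [hx', hy']; linarith

/-- A convex set containing the vertices of the hexagon contains the hexagon. -/
lemma hexagon_mem {E : Type*} [AddCommGroup E] [Module ℝ E] {K : Set E} (hK : Convex ℝ K)
    {e f : E} {s : ℝ} (hs : 1 < s) (hse : s • e ∈ K) (hse' : (-s) • e ∈ K)
    (hv : ∀ σ τ : ℝ, |σ| = 1 → |τ| = 1 → (σ / 2) • e + (τ / 2) • f ∈ K)
    {x y : ℝ} (hy : |y| ≤ 1 / 2) (hxy : |x| + (2 * s - 1) * |y| ≤ s) :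
    x • e + y • f ∈ K := by
  obtain ⟨τ, hτ, hyτ⟩ : ∃ τ : ℝ, |τ| = 1 ∧ y = |y| * τ := by
    rcases le_total 0 y with h | h
    · exact ⟨1, by simp, by rw [abs_of_nonneg h]; ring⟩
    · exact ⟨-1, by simp, by rw [abs_of_nonpos h]; ring⟩
  set c := |y|
  have hc : 0 ≤ c := abs_nonneg y
  set L := s - (2 * s - 1) * c with hL
  have hLpos : 0 < L := by rw [hL]; nlinarith
  obtain ⟨hx1, hx2⟩ := abs_le.1 (show |x| ≤ L by linarith)
  have hright : L • e + y • f ∈ K := by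
    have := hK hse (hv 1 τ (by simp) hτ) (a := 1 - 2 * c) (b := 2 * c) (by linarith)
      (by linarith) (by ring)
    convert this using 1
    rw [hyτ, hL]; module
  have hleft : (-L) • e + y • f ∈ K := by
    have := hK hse' (hv (-1) τ (by simp) hτ) (a := 1 - 2 * c) (b := 2 * c) (by linarith)
      (by linarith) (by ring)
    convert this using 1
    rw [hyτ, hL]; module
  have := hK hright hleft (a := (L + x) / (2 * L)) (b := (L - x) / (2 * L))
    (div_nonneg (by linarith) (by linarith)) (div_nonneg (by linarith) (by linarith))
    (by field_simp; ring)
  convert this using 1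
  have h1 : x = (L + x) / (2 * L) * L - (L - x) / (2 * L) * L := by field_simp; ring
  have h2 : y = (L + x) / (2 * L) * y + (L - x) / (2 * L) * y := by field_simp; ring
  nth_rewrite 1 [h1, h2]
  module

/-- A symmetric convex set containing the unit disk and a point at distance `s > 1` from the
origin contains a lattice hexagon tile of area `√3 * (s + 1 / 2)`. -/
lemma exists_covering_of_norm_gt_one {K : Set (Euc 2)} (hconv : Convex ℝ K) (hsymm : K = -K)
    (hKB : unitBall 2 ⊆ K) {P : Euc 2} (hP : P ∈ K) (hP1 : 1 < ‖P‖) :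
    ∃ T : Euc 2 →ₗ[ℝ] Euc 2, IsCoveringLattice T K ∧
      LinearMap.det T = √3 * (‖P‖ + 1 / 2) := by
  set s := ‖P‖ with hs
  have hs0 : s ≠ 0 := by linarith
  have h3 : √3 ^ 2 = 3 := Real.sq_sqrt (by norm_num)
  have h30 : √3 ≠ 0 := by positivity
  have hsq : P 0 ^ 2 + P 1 ^ 2 = s ^ 2 := by
    rw [hs, EuclideanSpace.norm_sq_eq, Fin.sum_univ_two]; simp
  obtain ⟨α, hα⟩ : ∃ α, α = P 0 / s := ⟨_, rfl⟩
  obtain ⟨β, hβ⟩ : ∃ β, β = P 1 / s := ⟨_, rfl⟩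
  have hαβ : α ^ 2 + β ^ 2 = 1 := by
    rw [hα, hβ]; field_simp; exact hsq
  set e : Euc 2 := !₂[α, β] with he
  set f : Euc 2 := !₂[-(√3 * β), √3 * α] with hf
  have hse : s • e = P := by
    ext i; fin_cases i <;> simp [he, hα, hβ] <;> field_simp
  have hse' : (-s) • e ∈ K := by
    rw [hsymm, neg_smul, hse]; simpa using hP
  have hv : ∀ σ τ : ℝ, |σ| = 1 → |τ| = 1 → (σ / 2) • e + (τ / 2) • f ∈ K := by
    intro σ τ hσ hτ
    apply hKB
    have hσ2 : σ ^ 2 = 1 := by rw [← sq_abs, hσ, one_pow]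
    have hτ2 : τ ^ 2 = 1 := by rw [← sq_abs, hτ, one_pow]
    rw [unitBall, mem_closedBall_zero_iff]
    refine (sq_le_sq₀ (by positivity) zero_le_one).1 ?_
    rw [EuclideanSpace.norm_sq_eq, Fin.sum_univ_two]
    simp only [he, hf, PiLp.add_apply, PiLp.smul_apply, smul_eq_mul, Real.norm_eq_abs, sq_abs,
      Matrix.cons_val_zero, Matrix.cons_val_one]
    apply le_of_eq
    linear_combination (σ ^ 2 / 4 + τ ^ 2 / 4 * √3 ^ 2) * hαβ + 1 / 4 * hσ2
      + √3 ^ 2 / 4 * hτ2 + 1 / 4 * h3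
  set T : Euc 2 →ₗ[ℝ] Euc 2 := Matrix.toEuclideanLin
    !![(s + 1 / 2) * α - √3 * β / 2, -(√3 * β); (s + 1 / 2) * β + √3 * α / 2, √3 * α] with hTdef
  have hT0 : T !₂[1, 0] = (s + 1 / 2) • e + (1 / 2 : ℝ) • f := by
    ext i; fin_cases i <;> simp [hTdef, he, hf, Matrix.toLpLin_apply] <;> ring
  have hT1 : T !₂[0, 1] = f := by
    ext i; fin_cases i <;> simp [hTdef, hf, Matrix.toLpLin_apply]
  refine ⟨T, ?_, ?_⟩
  · rw [isCoveringLattice_iff_exists_int]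
    intro x
    have hx : x = (α * x 0 + β * x 1) • e + ((α * x 1 - β * x 0) / √3) • f := by
      ext i
      fin_cases i <;> simp [he, hf] <;> field_simp
      · linear_combination -(x 0) * hαβ
      · linear_combination -(x 1) * hαβ
    obtain ⟨m, n, h1, h2⟩ :=
      exists_int_hexagon hP1 (α * x 0 + β * x 1) ((α * x 1 - β * x 0) / √3)
    refine ⟨m, n, ?_⟩
    have := hexagon_mem hconv hP1 (hse ▸ hP) hse' hv h1 h2
    convert this using 1
    rw [hT0, hT1]
    nth_rewrite 1 [hx]
    module
  · rw [det_euc_two, hT0, hT1]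
    simp [he, hf]
    linear_combination √3 * (s + 1 / 2) * hαβ

/-- The disk `B²` is inextensible: every origin-symmetric convex body properly containing
`B²` has strictly larger critical covering determinant. -/
theorem ball2_inextensible (K : Set (Euc 2)) (hK : IsSymmConvexBody K)
    (hKB : unitBall 2 ⊂ K) :
    critCoveringDet (unitBall 2) < critCoveringDet K := by
  obtain ⟨hcomp, hconv, -, hsymm⟩ := hK
  obtain ⟨hsub, P, hP, hPB⟩ := Set.ssubset_iff_exists.1 hKB
  have hP1 : 1 < ‖P‖ := by simpa [unitBall] using hPB
  obtain ⟨T, hT, hdet⟩ := exists_covering_of_norm_gt_one hconv hsymm hsub hP hP1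
  have hpos : 0 < √3 * (‖P‖ + 1 / 2) := by positivity
  obtain ⟨R, hR⟩ := hcomp.isBounded.subset_closedBall 0
  have hball : critCoveringDet (unitBall 2) ≤ 3 * √3 / 2 := by
    refine Real.sSup_le ?_ (by positivity)
    rintro d ⟨S, -, hS, rfl⟩
    simpa using abs_det_le_of_subset_closedBall (R := 1) subset_rfl hS
  have hle : √3 * (‖P‖ + 1 / 2) ≤ critCoveringDet K := by
    refine le_csSup ⟨3 * √3 / 2 * R ^ 2, ?_⟩
      ⟨T, by rw [hdet]; exact hpos.ne', hT, by rw [hdet, abs_of_pos hpos]⟩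
    rintro d ⟨S, -, hS, rfl⟩
    exact abs_det_le_of_subset_closedBall hR hS
  have h3 : 0 < √3 := by positivity
  nlinarith
end
end

section
/- The ball B⁴ is extensible: there exists an origin-symmetric convex body K in ℝ⁴ properly containing B⁴ such that d_K = d_{B⁴}, where d_K is the critical covering determinant of K. -/
open Set Pointwise MeasureTheory

noncomputable section

theorem prod_four_le (a b c d : ℝ) (ha : 0 ≤ a) (hb : 0 ≤ b) (hc : 0 ≤ c) (hd : 0 ≤ d) :
    a * b * c * d ≤ ((a + b + c + d) / 4) ^ 4 := by
  have h1 : a * b ≤ ((a + b) / 2) ^ 2 := by nlinarith [sq_nonneg (a - b)]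
  have h2 : c * d ≤ ((c + d) / 2) ^ 2 := by nlinarith [sq_nonneg (c - d)]
  have h3 : ((a + b) / 2) * ((c + d) / 2) ≤ ((a + b + c + d) / 4) ^ 2 := by
    nlinarith [sq_nonneg (a + b - c - d)]
  calc a * b * c * d = (a * b) * (c * d) := by ring
    _ ≤ ((a + b) / 2) ^ 2 * ((c + d) / 2) ^ 2 :=
        mul_le_mul h1 h2 (by positivity) (by positivity)
    _ = (((a + b) / 2) * ((c + d) / 2)) ^ 2 := by ring
    _ ≤ (((a + b + c + d) / 4) ^ 2) ^ 2 := by gcongr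
    _ = _ := by ring

theorem det_le_trace_pow {H : Matrix (Fin 4) (Fin 4) ℝ} (hH : H.PosSemidef) :
    H.det ≤ (H.trace / 4) ^ 4 := by
  have hd := hH.isHermitian.det_eq_prod_eigenvalues
  have ht := hH.isHermitian.trace_eq_sum_eigenvalues
  have h0 := hH.eigenvalues_nonneg
  simp only [Fin.prod_univ_four, Fin.sum_univ_four, RCLike.ofReal_real_eq_id, id] at hd ht
  rw [hd, ht]
  exact prod_four_le _ _ _ _ (h0 0) (h0 1) (h0 2) (h0 3)

/-- The arithmetic-geometric mean inequality for the pairing of a positive semidefinite matrix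
with a Gram matrix. -/
theorem det_mul_det_sq_le_trace_pow {N : Matrix (Fin 4) (Fin 4) ℝ} (hN : N.PosSemidef)
    (V : Matrix (Fin 4) (Fin 4) ℝ) :
    N.det * V.det ^ 2 ≤ ((N * (V * V.transpose)).trace / 4) ^ 4 := by
  have h := hN.conjTranspose_mul_mul_same V
  rw [Matrix.conjTranspose_eq_transpose_of_trivial] at h
  have h2 := det_le_trace_pow h
  rw [Matrix.det_mul, Matrix.det_mul, Matrix.det_transpose, Matrix.mul_assoc,
    Matrix.trace_mul_comm, Matrix.mul_assoc] at h2
  linarith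

/-- The real vector with given integer coordinates. -/
def intVec (n : Fin 4 → ℤ) : Fin 4 → ℝ := fun i => (n i : ℝ)

/-- The integer lattice `ℤ⁴`. -/
def zLat : Set (Fin 4 → ℝ) := Set.range intVec

/-- The checkerboard lattice `D₄`. -/
def d4Lat : Set (Fin 4 → ℝ) := intVec '' {n | Even (∑ i, n i)}

/-- Right multiplication by `M` is a bijection from the lattice `L₁` onto the lattice `L₂`. -/
structure LatIso (L₁ L₂ : Set (Fin 4 → ℝ)) (M : Matrix (Fin 4) (Fin 4) ℝ) : Prop where
  mapsTo : ∀ x ∈ L₁, Matrix.vecMul x M ∈ L₂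
  exists_inv : ∃ M' : Matrix (Fin 4) (Fin 4) ℝ, M * M' = 1 ∧ ∀ y ∈ L₂, Matrix.vecMul y M' ∈ L₁

namespace LatIso

variable {L₁ L₂ L₃ : Set (Fin 4 → ℝ)} {M N : Matrix (Fin 4) (Fin 4) ℝ}

theorem mul (hM : LatIso L₁ L₂ M) (hN : LatIso L₂ L₃ N) : LatIso L₁ L₃ (M * N) := by
  obtain ⟨hM1, M', hM2, hM3⟩ := hM
  obtain ⟨hN1, N', hN2, hN3⟩ := hN
  refine ⟨fun x hx => ?_, N' * M', ?_, fun y hy => ?_⟩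
  · rw [← Matrix.vecMul_vecMul]
    exact hN1 _ (hM1 _ hx)
  · rw [Matrix.mul_assoc, ← Matrix.mul_assoc N, hN2, Matrix.one_mul, hM2]
  · rw [← Matrix.vecMul_vecMul]
    exact hM3 _ (hN3 _ hy)

theorem of_inverse (h : M * N = 1) (hM : ∀ x ∈ L₁, Matrix.vecMul x M ∈ L₂)
    (hN : ∀ y ∈ L₂, Matrix.vecMul y N ∈ L₁) : LatIso L₁ L₂ M :=
  ⟨hM, N, h, hN⟩

theorem symm_of_inverse (hM : LatIso L₁ L₂ M) (h : M * N = 1) : LatIso L₂ L₁ N := by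
  obtain ⟨hM1, M', hM2, hM3⟩ := hM
  have : M' = N := by
    rw [← Matrix.one_mul M', ← mul_eq_one_comm.mp h, Matrix.mul_assoc, hM2, Matrix.mul_one]
  subst this
  exact ⟨hM3, M, mul_eq_one_comm.mp h, hM1⟩

theorem exists_preimage (hM : LatIso L₁ L₂ M) {y : Fin 4 → ℝ} (hy : y ∈ L₂) :
    ∃ x ∈ L₁, Matrix.vecMul x M = y := by
  obtain ⟨_, M', hM2, hM3⟩ := hM
  refine ⟨_, hM3 y hy, ?_⟩
  rw [Matrix.vecMul_vecMul, mul_eq_one_comm.mp hM2, Matrix.vecMul_one]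

theorem det_ne_zero (hM : LatIso L₁ L₂ M) : M.det ≠ 0 := by
  obtain ⟨_, M', h, _⟩ := hM
  intro h0
  have := congrArg Matrix.det h
  rw [Matrix.det_mul, h0, Matrix.det_one] at this
  norm_num at this

theorem one : LatIso L₁ L₁ 1 :=
  of_inverse (N := 1) (by simp) (by simp) (by simp)

end LatIso

theorem exists_int_matrix {M : Matrix (Fin 4) (Fin 4) ℝ}
    (h : ∀ x ∈ zLat, Matrix.vecMul x M ∈ zLat) :
    ∃ Z : Matrix (Fin 4) (Fin 4) ℤ, M = Z.map (Int.cast : ℤ → ℝ) := by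
  have h1 : ∀ i, ∃ n : Fin 4 → ℤ, intVec n = M i := by
    intro i
    obtain ⟨n, hn⟩ := h (Pi.single i 1) ⟨Pi.single i 1, by
      ext j
      by_cases hj : j = i
      · subst hj; simp [intVec]
      · simp [intVec, hj]⟩
    exact ⟨n, by rw [hn, Matrix.single_one_vecMul]; rfl⟩
  choose Z hZ using h1
  refine ⟨Z, ?_⟩
  ext i j
  rw [← hZ i]
  rfl

theorem det_intCast (Z : Matrix (Fin 4) (Fin 4) ℤ) :
    (Z.map (Int.cast : ℤ → ℝ)).det = (Z.det : ℝ) := by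
  have := (Int.castRingHom ℝ).map_det Z
  simpa using this.symm

theorem abs_det_eq_one {M N : Matrix (Fin 4) (Fin 4) ℝ} (h : M * N = 1)
    (hM : ∀ x ∈ zLat, Matrix.vecMul x M ∈ zLat) (hN : ∀ x ∈ zLat, Matrix.vecMul x N ∈ zLat) :
    |M.det| = 1 := by
  obtain ⟨Z, rfl⟩ := exists_int_matrix hM
  obtain ⟨Y, rfl⟩ := exists_int_matrix hN
  have h1 := congrArg Matrix.det h
  rw [Matrix.det_mul, det_intCast, det_intCast, Matrix.det_one] at h1
  have h2 : Z.det * Y.det = 1 := by exact_mod_cast h1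
  rw [det_intCast]
  have h3 := Int.isUnit_iff.mp (IsUnit.of_mul_eq_one _ h2)
  rcases h3 with h3 | h3 <;> rw [h3] <;> norm_num

theorem LatIso.abs_det {M : Matrix (Fin 4) (Fin 4) ℝ} (h : LatIso zLat zLat M) : |M.det| = 1 := by
  obtain ⟨h1, M', h2, h3⟩ := h
  exact abs_det_eq_one h2 h1 h3

/-- Rows: four of the five vectors of a superbase of `D₄`. -/
def d4Superbase : Matrix (Fin 4) (Fin 4) ℝ :=
  !![0, 1, 1, 0; -1, -1, 0, 0; -1, 0, -1, 0; 1, 0, 0, 1]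

/-- The inverse of `d4Superbase`. -/
def d4SuperbaseInv : Matrix (Fin 4) (Fin 4) ℝ :=
  !![-1/2, -1/2, -1/2, 0; 1/2, -1/2, 1/2, 0; 1/2, 1/2, -1/2, 0; 1/2, 1/2, 1/2, 1]

/-- An automorphism of `D₄` that is not an isometry. -/
def d4Shear : Matrix (Fin 4) (Fin 4) ℝ :=
  !![0, 1, 1/2, 1/2; 1, 0, 1/2, 1/2; -1, 0, 1/2, 1/2; 0, 0, 1/2, -1/2]

/-- The inverse of `d4Shear`. -/
def d4ShearInv : Matrix (Fin 4) (Fin 4) ℝ :=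
  !![0, 1/2, -1/2, 0; 1, -1/2, -1/2, 0; 0, 1/2, 1/2, 1; 0, 1/2, 1/2, -1]

/-- An isometry of `D₄` exchanging the coordinate frame with the frame of even half-integral
vectors. -/
def d4Hadamard : Matrix (Fin 4) (Fin 4) ℝ :=
  !![1/2, 1/2, 1/2, 1/2; 1/2, 1/2, -1/2, -1/2; 1/2, -1/2, 1/2, -1/2; 1/2, -1/2, -1/2, 1/2]

/-- An isometry of `D₄` exchanging the coordinate frame with the frame of odd half-integral
vectors. -/
def d4Reflection : Matrix (Fin 4) (Fin 4) ℝ :=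
  !![-1/2, 1/2, 1/2, 1/2; 1/2, -1/2, 1/2, 1/2; 1/2, 1/2, -1/2, 1/2; 1/2, 1/2, 1/2, -1/2]

theorem mem_d4Lat {x : Fin 4 → ℝ} :
    x ∈ d4Lat ↔ ∃ a b c d k : ℤ, a + b + c + d = k + k ∧ x = ![(a : ℝ), b, c, d] := by
  constructor
  · rintro ⟨n, ⟨k, hk⟩, rfl⟩
    rw [Fin.sum_univ_four] at hk
    refine ⟨_, _, _, _, k, hk, ?_⟩
    ext i; fin_cases i <;> rfl
  · rintro ⟨a, b, c, d, k, h, rfl⟩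
    refine ⟨![a, b, c, d], ⟨k, ?_⟩, ?_⟩
    · simpa [Fin.sum_univ_four] using h
    · ext i; fin_cases i <;> rfl

theorem mem_zLat {x : Fin 4 → ℝ} :
    x ∈ zLat ↔ ∃ a b c d : ℤ, x = ![(a : ℝ), b, c, d] := by
  constructor
  · rintro ⟨n, rfl⟩
    refine ⟨n 0, n 1, n 2, n 3, ?_⟩
    ext i; fin_cases i <;> rfl
  · rintro ⟨a, b, c, d, rfl⟩
    refine ⟨![a, b, c, d], ?_⟩
    ext i; fin_cases i <;> rfl

theorem latIso_d4Superbase : LatIso zLat d4Lat d4Superbase := by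
  refine LatIso.of_inverse (N := d4SuperbaseInv) ?_ (fun x hx => ?_) fun x hx => ?_
  · ext i j
    fin_cases i <;> fin_cases j <;>
      simp [d4Superbase, d4SuperbaseInv, Matrix.mul_apply, Fin.sum_univ_four] <;> norm_num
  · obtain ⟨a, b, c, d, rfl⟩ := mem_zLat.mp hx
    refine mem_d4Lat.mpr ⟨-b - c + d, a - b, a - c, d, a - b - c + d, by ring, ?_⟩
    ext i
    fin_cases i <;> simp [d4Superbase, Matrix.vecMul, dotProduct, Fin.sum_univ_four] <;> ring
  · obtain ⟨a, b, c, d, k, hk, rfl⟩ := mem_d4Lat.mp hx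
    have hk' : (a : ℝ) + b + c + d = k + k := by exact_mod_cast hk
    refine mem_zLat.mpr ⟨k - a, k - a - b, k - a - c, d, ?_⟩
    ext i
    fin_cases i <;> simp [d4SuperbaseInv, Matrix.vecMul, dotProduct, Fin.sum_univ_four] <;>
      linarith

theorem latIso_d4SuperbaseInv : LatIso d4Lat zLat d4SuperbaseInv := by
  refine latIso_d4Superbase.symm_of_inverse ?_
  ext i j
  fin_cases i <;> fin_cases j <;>
      simp [d4Superbase, d4SuperbaseInv, Matrix.mul_apply, Fin.sum_univ_four] <;> norm_num

theorem latIso_d4Shear : LatIso d4Lat d4Lat d4Shear := by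
  refine LatIso.of_inverse (N := d4ShearInv) ?_ (fun x hx => ?_) fun x hx => ?_
  · ext i j
    fin_cases i <;> fin_cases j <;>
      simp [d4Shear, d4ShearInv, Matrix.mul_apply, Fin.sum_univ_four] <;> norm_num
  · obtain ⟨a, b, c, d, k, hk, rfl⟩ := mem_d4Lat.mp hx
    have hk' : (a : ℝ) + b + c + d = k + k := by exact_mod_cast hk
    refine mem_d4Lat.mpr ⟨b - c, a, k, k - d, a + b, ?_, ?_⟩
    · linarith
    · ext i
      fin_cases i <;> simp [d4Shear, Matrix.vecMul, dotProduct, Fin.sum_univ_four] <;>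
        linarith
  · obtain ⟨a, b, c, d, k, hk, rfl⟩ := mem_d4Lat.mp hx
    have hk' : (a : ℝ) + b + c + d = k + k := by exact_mod_cast hk
    refine mem_d4Lat.mpr ⟨b, k - b, k - a - b, c - d, c, by linarith, ?_⟩
    ext i
    fin_cases i <;> simp [d4ShearInv, Matrix.vecMul, dotProduct, Fin.sum_univ_four] <;>
      linarith

theorem latIso_d4Hadamard : LatIso d4Lat d4Lat d4Hadamard := by
  have h : ∀ x ∈ d4Lat, Matrix.vecMul x d4Hadamard ∈ d4Lat := fun x hx => by
    obtain ⟨a, b, c, d, k, hk, rfl⟩ := mem_d4Lat.mp hx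
    have hk' : (a : ℝ) + b + c + d = k + k := by exact_mod_cast hk
    refine mem_d4Lat.mpr ⟨k, k - c - d, k - b - d, k - b - c, a, ?_, ?_⟩
    · linarith
    · ext i
      fin_cases i <;> simp [d4Hadamard, Matrix.vecMul, dotProduct, Fin.sum_univ_four] <;>
        linarith
  refine LatIso.of_inverse (N := d4Hadamard) ?_ h h
  ext i j
  fin_cases i <;> fin_cases j <;>
      simp [d4Hadamard, Matrix.mul_apply, Fin.sum_univ_four] <;> norm_num

theorem latIso_d4Reflection : LatIso d4Lat d4Lat d4Reflection := by
  have h : ∀ x ∈ d4Lat, Matrix.vecMul x d4Reflection ∈ d4Lat := fun x hx => by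
    obtain ⟨a, b, c, d, k, hk, rfl⟩ := mem_d4Lat.mp hx
    have hk' : (a : ℝ) + b + c + d = k + k := by exact_mod_cast hk
    refine mem_d4Lat.mpr ⟨k - a, k - b, k - c, k - d, k, by linarith, ?_⟩
    ext i
    fin_cases i <;> simp [d4Reflection, Matrix.vecMul, dotProduct, Fin.sum_univ_four] <;>
      linarith
  refine LatIso.of_inverse (N := d4Reflection) ?_ h h
  ext i j
  fin_cases i <;> fin_cases j <;>
      simp [d4Reflection, Matrix.mul_apply, Fin.sum_univ_four] <;> norm_num

/-- The translates of `K` by the vectors of the image of `L` under `V` cover the space. -/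
def Covers (L : Set (Fin 4 → ℝ)) (V : Matrix (Fin 4) (Fin 4) ℝ) (K : Set (Fin 4 → ℝ)) : Prop :=
  ∀ x, ∃ l ∈ L, x - Matrix.vecMul l V ∈ K

theorem Covers.of_latIso {L₁ L₂ : Set (Fin 4 → ℝ)} {P V : Matrix (Fin 4) (Fin 4) ℝ}
    {K : Set (Fin 4 → ℝ)} (h : Covers L₂ V K) (hP : LatIso L₁ L₂ P) : Covers L₁ (P * V) K := by
  intro x
  obtain ⟨l, hl, hx⟩ := h x
  obtain ⟨l', hl', rfl⟩ := hP.exists_preimage hl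
  exact ⟨l', hl', by rwa [← Matrix.vecMul_vecMul]⟩

theorem Covers.mono {L : Set (Fin 4 → ℝ)} {V : Matrix (Fin 4) (Fin 4) ℝ}
    {K K' : Set (Fin 4 → ℝ)} (h : Covers L V K) (hK : K ⊆ K') : Covers L V K' := fun x =>
  (h x).imp fun _ hl => ⟨hl.1, hK hl.2⟩

/-- The ball of squared radius `r` in coordinates. -/
def sqBall (r : ℝ) : Set (Fin 4 → ℝ) := {x | x ⬝ᵥ x ≤ r}

theorem exists_dotProduct_eq {V : Matrix (Fin 4) (Fin 4) ℝ} (hV : V.det ≠ 0) (η : Fin 4 → ℝ) :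
    ∃ y : Fin 4 → ℝ, ∀ j, V j ⬝ᵥ y = η j := by
  refine ⟨Matrix.mulVec V⁻¹ η, fun j => ?_⟩
  have h : Matrix.mulVec V (Matrix.mulVec V⁻¹ η) = η := by
    rw [Matrix.mulVec_mulVec, Matrix.mul_nonsing_inv _ (isUnit_iff_ne_zero.mpr hV),
      Matrix.one_mulVec]
  exact congrFun h j

theorem dotProduct_self_nonneg' (x : Fin 4 → ℝ) : 0 ≤ x ⬝ᵥ x :=
  Finset.sum_nonneg fun i _ => mul_self_nonneg (x i)

theorem vecMul_dotProduct_eq_sum (w : Fin 4 → ℝ) (V : Matrix (Fin 4) (Fin 4) ℝ)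
    (y : Fin 4 → ℝ) : Matrix.vecMul w V ⬝ᵥ y = ∑ j, w j * (V j ⬝ᵥ y) := by
  simp only [Matrix.vecMul, dotProduct, Fin.sum_univ_four]
  ring

theorem sub_dotProduct_self (x y : Fin 4 → ℝ) :
    (x - y) ⬝ᵥ (x - y) = x ⬝ᵥ x - 2 * (y ⬝ᵥ x) + y ⬝ᵥ y := by
  simp only [dotProduct, Fin.sum_univ_four, Pi.sub_apply]
  ring

/-- Some signed sum of a set of vectors is at most as long as in the orthogonal case. -/
theorem exists_signs (V : Matrix (Fin 4) (Fin 4) ℝ) (m : Fin 4) :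
    ∃ ε : Fin 4 → ℝ, ε m = 0 ∧ (∀ j, j ≠ m → ε j = 1 ∨ ε j = -1) ∧
      Matrix.vecMul ε V ⬝ᵥ Matrix.vecMul ε V ≤ ∑ j, V j ⬝ᵥ V j - V m ⬝ᵥ V m := by
  have expand : ∀ ε : Fin 4 → ℝ, Matrix.vecMul ε V ⬝ᵥ Matrix.vecMul ε V =
      ε 0 ^ 2 * (V 0 ⬝ᵥ V 0) + ε 1 ^ 2 * (V 1 ⬝ᵥ V 1) + ε 2 ^ 2 * (V 2 ⬝ᵥ V 2) +
      ε 3 ^ 2 * (V 3 ⬝ᵥ V 3) + 2 * (ε 0 * ε 1 * (V 0 ⬝ᵥ V 1) + ε 0 * ε 2 * (V 0 ⬝ᵥ V 2) +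
      ε 0 * ε 3 * (V 0 ⬝ᵥ V 3) + ε 1 * ε 2 * (V 1 ⬝ᵥ V 2) + ε 1 * ε 3 * (V 1 ⬝ᵥ V 3) +
      ε 2 * ε 3 * (V 2 ⬝ᵥ V 3)) := by
    intro ε
    simp only [Matrix.vecMul, dotProduct, Fin.sum_univ_four]
    ring
  by_contra! h
  have hs : ∀ s : Fin 4 → ℝ, (∀ j, s j = 1 ∨ s j = -1) →
      ∑ j, V j ⬝ᵥ V j - V m ⬝ᵥ V m <
        Matrix.vecMul (fun j => if j = m then 0 else s j) V ⬝ᵥ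
          Matrix.vecMul (fun j => if j = m then 0 else s j) V := fun s hs =>
    h _ (if_pos rfl) fun j hj => by simpa only [if_neg hj] using hs j
  have h1 := hs ![1, 1, 1, 1] (by simp [Fin.forall_fin_succ])
  have h2 := hs ![1, 1, 1, -1] (by simp [Fin.forall_fin_succ])
  have h3 := hs ![1, 1, -1, 1] (by simp [Fin.forall_fin_succ])
  have h4 := hs ![1, 1, -1, -1] (by simp [Fin.forall_fin_succ])
  have h5 := hs ![1, -1, 1, 1] (by simp [Fin.forall_fin_succ])
  have h6 := hs ![1, -1, 1, -1] (by simp [Fin.forall_fin_succ])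
  have h7 := hs ![1, -1, -1, 1] (by simp [Fin.forall_fin_succ])
  have h8 := hs ![1, -1, -1, -1] (by simp [Fin.forall_fin_succ])
  rw [expand, Fin.sum_univ_four] at h1 h2 h3 h4 h5 h6 h7 h8
  fin_cases m <;> simp at h1 h2 h3 h4 h5 h6 h7 h8 <;> linarith

/-- A lower bound for the covering radius of the image of the checkerboard lattice. -/
theorem le_of_covers_d4Lat {V : Matrix (Fin 4) (Fin 4) ℝ} (hV : V.det ≠ 0) {r : ℝ}
    (hcov : Covers d4Lat V (sqBall r)) (m : Fin 4)
    (hodd : ∀ n : Fin 4 → ℤ, Odd (∑ i, n i) →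
      V m ⬝ᵥ V m + ∑ j, |intVec n j| * (V j ⬝ᵥ V j - V m ⬝ᵥ V m) ≤
        Matrix.vecMul (intVec n) V ⬝ᵥ Matrix.vecMul (intVec n) V)
    (hmin : ∀ j, V m ⬝ᵥ V m ≤ V j ⬝ᵥ V j) :
    4 * ∑ j, V j ⬝ᵥ V j + 6 * (V m ⬝ᵥ V m) ≤ 25 * r := by
  obtain ⟨ε, hεm, hε, hεV⟩ := exists_signs V m
  obtain ⟨y, hy⟩ := exists_dotProduct_eq hV fun j => ε j * (V j ⬝ᵥ V j - V m ⬝ᵥ V m) / 2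
  obtain ⟨l, ⟨n, hn, rfl⟩, hl⟩ := hcov (V m + y)
  have hrow : Matrix.vecMul (Pi.single m 1) V = V m := Matrix.single_one_vecMul m V
  set w : Fin 4 → ℤ := n - Pi.single m 1 with hw
  have hwv : intVec w = intVec n - Pi.single m 1 := by
    ext j
    by_cases hj : j = m
    · subst hj; simp [intVec, hw]
    · simp [intVec, hw, hj]
  have hwodd : Odd (∑ i, w i) := by
    have : ∑ i, w i = ∑ i, n i - 1 := by simp [hw]
    rw [this]
    exact hn.sub_odd odd_one
  have hdiff : V m + y - Matrix.vecMul (intVec n) V = y - Matrix.vecMul (intVec w) V := by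
    rw [hwv, Matrix.sub_vecMul, hrow]; abel
  have habs : ∀ j, |ε j| ≤ 1 := fun j => by
    by_cases hj : j = m
    · subst hj; simp [hεm]
    · rcases hε j hj with h | h <;> simp [h]
  have hl' : (y - Matrix.vecMul (intVec w) V) ⬝ᵥ (y - Matrix.vecMul (intVec w) V) ≤ r := by
    rw [← hdiff]; exact hl
  rw [sub_dotProduct_self, vecMul_dotProduct_eq_sum] at hl'
  have h1 : 2 * ∑ j, intVec w j * (V j ⬝ᵥ y) ≤
      ∑ j, |intVec w j| * (V j ⬝ᵥ V j - V m ⬝ᵥ V m) := by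
    rw [Finset.mul_sum]
    refine Finset.sum_le_sum fun j _ => ?_
    have h2 : intVec w j * ε j ≤ |intVec w j| := by
      calc intVec w j * ε j ≤ |intVec w j * ε j| := le_abs_self _
        _ = |intVec w j| * |ε j| := abs_mul _ _
        _ ≤ |intVec w j| * 1 := by gcongr; exact habs j
        _ = _ := mul_one _
    have h3 := mul_le_mul_of_nonneg_right h2 (sub_nonneg.mpr (hmin j))
    rw [hy]
    linarith
  have h2 := hodd w hwodd
  have h3 := dotProduct_self_nonneg' (y - Matrix.vecMul ((1 / 5 : ℝ) • ε) V)
  rw [sub_dotProduct_self, Matrix.smul_vecMul, smul_dotProduct, smul_dotProduct,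
    dotProduct_smul, vecMul_dotProduct_eq_sum] at h3
  have h4 : ∑ j, ε j * (V j ⬝ᵥ y) =
      (∑ j, V j ⬝ᵥ V j - V m ⬝ᵥ V m - 3 * (V m ⬝ᵥ V m)) / 2 := by
    have h5 : ∀ j, ε j * (V j ⬝ᵥ y) = (V j ⬝ᵥ V j - V m ⬝ᵥ V m) / 2 := fun j => by
      rw [hy]
      by_cases hj : j = m
      · subst hj; simp
      · have : ε j ^ 2 = 1 := sq_eq_one_iff.mpr (hε j hj)
        linear_combination (V j ⬝ᵥ V j - V m ⬝ᵥ V m) / 2 * this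
    simp only [h5, Fin.sum_univ_four]
    ring
  rw [h4] at h3
  simp only [smul_eq_mul] at h3
  linarith

/-- The quadratic form of `D₄`-type with the given nonnegative coefficients on the three
coordinate frames. -/
def d4Form (a b c x : Fin 4 → ℝ) : ℝ :=
  ∑ j, (a j * x j ^ 2 + b j * Matrix.vecMul x d4Hadamard j ^ 2 +
    c j * Matrix.vecMul x d4Reflection j ^ 2)

theorem vecMul_d4Hadamard (x : Fin 4 → ℝ) : Matrix.vecMul x d4Hadamard =
    ![(x 0 + x 1 + x 2 + x 3) / 2, (x 0 + x 1 - x 2 - x 3) / 2, (x 0 - x 1 + x 2 - x 3) / 2,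
      (x 0 - x 1 - x 2 + x 3) / 2] := by
  ext i
  fin_cases i <;> simp [Matrix.vecMul, dotProduct, Fin.sum_univ_four, d4Hadamard] <;> ring

theorem vecMul_d4Reflection (x : Fin 4 → ℝ) : Matrix.vecMul x d4Reflection =
    ![(-x 0 + x 1 + x 2 + x 3) / 2, (x 0 - x 1 + x 2 + x 3) / 2, (x 0 + x 1 - x 2 + x 3) / 2,
      (x 0 + x 1 + x 2 - x 3) / 2] := by
  ext i
  fin_cases i <;> simp [Matrix.vecMul, dotProduct, Fin.sum_univ_four, d4Reflection] <;> ring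

theorem d4Form_vecMul_d4Hadamard (a b c x : Fin 4 → ℝ) :
    d4Form a b c (Matrix.vecMul x d4Hadamard) = d4Form b a c x := by
  simp only [d4Form, vecMul_d4Hadamard, vecMul_d4Reflection, Fin.sum_univ_four]
  simp
  ring

theorem d4Form_vecMul_d4Reflection (a b c x : Fin 4 → ℝ) :
    d4Form a b c (Matrix.vecMul x d4Reflection) = d4Form c b a x := by
  simp only [d4Form, vecMul_d4Hadamard, vecMul_d4Reflection, Fin.sum_univ_four]
  simp
  ring

theorem d4Form_single (a b c : Fin 4 → ℝ) (m : Fin 4) :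
    d4Form a b c (Pi.single m 1) = a m + (∑ j, (b j + c j)) / 4 := by
  simp only [d4Form, vecMul_d4Hadamard, vecMul_d4Reflection, Fin.sum_univ_four]
  fin_cases m <;> simp <;> ring

theorem quarter_le_sq_of_odd {k : ℤ} (hk : Odd k) {z : ℝ} (hz : z = (k : ℝ) / 2) :
    1 / 4 ≤ z ^ 2 := by
  have h0 : k ≠ 0 := by rintro rfl; simp at hk
  have h1 : (1 : ℤ) ≤ k ^ 2 := by
    have : 0 < k ^ 2 := by positivity
    omega
  have h2 : (1 : ℝ) ≤ (k : ℝ) ^ 2 := by exact_mod_cast h1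
  rw [hz]
  nlinarith

theorem d4Form_odd {a b c : Fin 4 → ℝ} (ha : ∀ j, 0 ≤ a j) (hb : ∀ j, 0 ≤ b j)
    (hc : ∀ j, 0 ≤ c j) (m : Fin 4) {n : Fin 4 → ℤ}
    (hn : Odd (∑ i, n i)) :
    a m + (∑ j, (b j + c j)) / 4 + ∑ j, |intVec n j| * (a j - a m) ≤ d4Form a b c (intVec n) := by
  have h1 : ∀ j, 1 / 4 ≤ Matrix.vecMul (intVec n) d4Hadamard j ^ 2 := by
    rw [vecMul_d4Hadamard]
    rw [Fin.sum_univ_four] at hn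
    intro j
    fin_cases j
    · exact quarter_le_sq_of_odd hn (by simp [intVec])
    · exact quarter_le_sq_of_odd (k := n 0 + n 1 - n 2 - n 3)
        (by obtain ⟨k, hk⟩ := hn; exact ⟨k - n 2 - n 3, by omega⟩) (by simp [intVec])
    · exact quarter_le_sq_of_odd (k := n 0 - n 1 + n 2 - n 3)
        (by obtain ⟨k, hk⟩ := hn; exact ⟨k - n 1 - n 3, by omega⟩) (by simp [intVec])
    · exact quarter_le_sq_of_odd (k := n 0 - n 1 - n 2 + n 3)
        (by obtain ⟨k, hk⟩ := hn; exact ⟨k - n 1 - n 2, by omega⟩) (by simp [intVec])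
  have h2 : ∀ j, 1 / 4 ≤ Matrix.vecMul (intVec n) d4Reflection j ^ 2 := by
    rw [vecMul_d4Reflection]
    rw [Fin.sum_univ_four] at hn
    obtain ⟨k, hk⟩ := hn
    intro j
    fin_cases j
    · exact quarter_le_sq_of_odd (k := -n 0 + n 1 + n 2 + n 3) ⟨k - n 0, by omega⟩
        (by simp [intVec])
    · exact quarter_le_sq_of_odd (k := n 0 - n 1 + n 2 + n 3) ⟨k - n 1, by omega⟩
        (by simp [intVec])
    · exact quarter_le_sq_of_odd (k := n 0 + n 1 - n 2 + n 3) ⟨k - n 2, by omega⟩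
        (by simp [intVec])
    · exact quarter_le_sq_of_odd (k := n 0 + n 1 + n 2 - n 3) ⟨k - n 3, by omega⟩
        (by simp [intVec])
  have habs : ∀ j, |intVec n j| = ((|n j| : ℤ) : ℝ) := fun j => by simp [intVec]
  have h3 : ∀ j, |intVec n j| ≤ intVec n j ^ 2 := fun j => by
    have h4 : |n j| ≤ n j ^ 2 := by
      rw [← sq_abs]
      rcases (abs_nonneg (n j)).eq_or_lt with h | h
      · rw [← h]; norm_num
      · nlinarith
    rw [habs]
    have : ((|n j| : ℤ) : ℝ) ≤ ((n j ^ 2 : ℤ) : ℝ) := by exact_mod_cast h4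
    simpa [intVec] using this
  have h5 : (1 : ℝ) ≤ ∑ j, |intVec n j| := by
    have h6 : (1 : ℤ) ≤ ∑ j, |n j| := by
      by_contra! h
      have h7 : ∀ j ∈ Finset.univ, |n j| = 0 :=
        (Finset.sum_eq_zero_iff_of_nonneg fun j _ => abs_nonneg (n j)).mp
          (le_antisymm (by omega) (Finset.sum_nonneg fun j _ => abs_nonneg (n j)))
      have h8 : ∑ j, n j = 0 := Finset.sum_eq_zero fun j hj => abs_eq_zero.mp (h7 j hj)
      rw [h8] at hn
      simp at hn
    simp only [habs]
    exact_mod_cast h6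
  have h9 : a m ≤ a m * ∑ j, |intVec n j| := le_mul_of_one_le_right (ha m) h5
  have h10 : ∀ j, a j * |intVec n j| + (b j + c j) / 4 ≤
      a j * intVec n j ^ 2 + b j * Matrix.vecMul (intVec n) d4Hadamard j ^ 2 +
    c j * Matrix.vecMul (intVec n) d4Reflection j ^ 2 := fun j => by
    have := mul_le_mul_of_nonneg_left (h1 j) (hb j)
    have := mul_le_mul_of_nonneg_left (h2 j) (hc j)
    have := mul_le_mul_of_nonneg_left (h3 j) (ha j)
    linarith
  have h11 := Finset.sum_le_sum fun j (_ : j ∈ Finset.univ) => h10 j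
  rw [d4Form]
  simp only [Fin.sum_univ_four] at *
  linarith

/-- The lower bound for the covering radius in terms of one coordinate frame of a form of
`D₄`-type. -/
theorem exists_le_of_d4Form {V : Matrix (Fin 4) (Fin 4) ℝ} (hV : V.det ≠ 0) {r : ℝ}
    (hcov : Covers d4Lat V (sqBall r)) {a b c : Fin 4 → ℝ} (ha : ∀ j, 0 ≤ a j)
    (hb : ∀ j, 0 ≤ b j) (hc : ∀ j, 0 ≤ c j)
    (hform : ∀ x, Matrix.vecMul x V ⬝ᵥ Matrix.vecMul x V = d4Form a b c x) :
    ∃ m, 4 * ∑ j, V j ⬝ᵥ V j + 6 * (V m ⬝ᵥ V m) ≤ 25 * r := by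
  obtain ⟨m, -, hm⟩ := Finset.exists_min_image Finset.univ a Finset.univ_nonempty
  have hQ : ∀ j, V j ⬝ᵥ V j = a j + (∑ j, (b j + c j)) / 4 := fun j => by
    rw [← d4Form_single, ← hform, Matrix.single_one_vecMul]
    rfl
  refine ⟨m, le_of_covers_d4Lat hV hcov m (fun n hn => ?_) fun j => ?_⟩
  · rw [hform]
    refine le_trans (le_of_eq ?_) (d4Form_odd ha hb hc m hn)
    simp only [hQ]
    congr 1
    exact Finset.sum_congr rfl fun j _ => by ring
  · rw [hQ, hQ]
    have := hm j (Finset.mem_univ j)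
    linarith

/-- The determinant of `8 I + 4 Uᵀ U` for three unit vectors pairwise at angles `π/3` or `2π/3`. -/
theorem le_det_add_gram (U : Matrix (Fin 3) (Fin 4) ℝ) (hd : ∀ i, U i ⬝ᵥ U i = 1)
    (ho : ∀ i j, i ≠ j → U i ⬝ᵥ U j = 1 / 2 ∨ U i ⬝ᵥ U j = -1 / 2) :
    12544 ≤ ((8 : ℝ) • (1 + (1 / 2 : ℝ) • (U.transpose * U))).det := by
  have h1 : (1 + (1 / 2 : ℝ) • (U.transpose * U)).det =
      (1 + (1 / 2 : ℝ) • (U * U.transpose)).det := by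
    rw [← Matrix.mul_smul, Matrix.det_one_add_mul_comm, Matrix.smul_mul]
  have hU : ∀ i j, (U * U.transpose) i j = U i ⬝ᵥ U j := fun i j => rfl
  have hs : ∀ i j, U i ⬝ᵥ U j = U j ⬝ᵥ U i := fun i j => dotProduct_comm _ _
  rw [Matrix.det_smul, h1, Matrix.det_fin_three]
  simp only [Matrix.add_apply, Matrix.smul_apply, hU, hd, hs 1 0, hs 2 0, hs 2 1, Fintype.card_fin,
    Matrix.one_apply, smul_eq_mul]
  rcases ho 0 1 (by decide) with h01 | h01 <;> rcases ho 0 2 (by decide) with h02 | h02 <;>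
    rcases ho 1 2 (by decide) with h12 | h12 <;> rw [h01, h02, h12] <;> simp <;> norm_num

theorem det_sq_le_of_frames {V : Matrix (Fin 4) (Fin 4) ℝ} {r : ℝ}
    (U : Matrix (Fin 3) (Fin 4) ℝ) (hd : ∀ i, U i ⬝ᵥ U i = 1)
    (ho : ∀ i j, i ≠ j → U i ⬝ᵥ U j = 1 / 2 ∨ U i ⬝ᵥ U j = -1 / 2)
    (h : 8 * ∑ j, V j ⬝ᵥ V j + 4 * ∑ i, (U * V) i ⬝ᵥ (U * V) i ≤ 50 * r) :
    12544 * V.det ^ 2 ≤ (25 / 2 * r) ^ 4 := by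
  have hN : ((8 : ℝ) • (1 + (1 / 2 : ℝ) • (U.transpose * U))).PosSemidef := by
    have h1 : (U.transpose * U).PosSemidef := by
      have := Matrix.posSemidef_conjTranspose_mul_self U
      rwa [Matrix.conjTranspose_eq_transpose_of_trivial] at this
    have h2 := (Matrix.PosSemidef.one (n := Fin 4) (R := ℝ)).add
      (h1.smul (by norm_num : (0 : ℝ) ≤ 1 / 2))
    have h3 := h2.smul (by norm_num : (0 : ℝ) ≤ 8)
    exact h3
  have h1 := det_mul_det_sq_le_trace_pow hN V
  have htr : ∀ {k : ℕ} (M : Matrix (Fin k) (Fin 4) ℝ),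
      (M * M.transpose).trace = ∑ i, M i ⬝ᵥ M i := fun M => rfl
  have h2 : (((8 : ℝ) • (1 + (1 / 2 : ℝ) • (U.transpose * U))) *
      (V * V.transpose)).trace = 8 * ∑ j, V j ⬝ᵥ V j + 4 * ∑ i, (U * V) i ⬝ᵥ (U * V) i := by
    have h3 : (U.transpose * U * (V * V.transpose)).trace =
        ((U * V) * (U * V).transpose).trace := by
      rw [Matrix.transpose_mul, Matrix.mul_assoc, Matrix.trace_mul_comm]
      simp only [Matrix.mul_assoc]
    rw [← htr, ← htr, ← h3, Matrix.smul_mul, Matrix.add_mul, Matrix.one_mul, Matrix.smul_mul,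
      Matrix.trace_smul, Matrix.trace_add, Matrix.trace_smul, smul_eq_mul, smul_eq_mul]
    ring
  rw [h2] at h1
  have h3 := mul_le_mul_of_nonneg_right (le_det_add_gram U hd ho) (sq_nonneg V.det)
  have h0 : 0 ≤ 8 * ∑ j, V j ⬝ᵥ V j + 4 * ∑ i, (U * V) i ⬝ᵥ (U * V) i := by
    have := Finset.sum_nonneg fun j (_ : j ∈ Finset.univ) => dotProduct_self_nonneg' (V j)
    have := Finset.sum_nonneg fun j (_ : j ∈ Finset.univ) => dotProduct_self_nonneg' ((U * V) j)
    positivity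
  calc 12544 * V.det ^ 2 ≤ _ := h3
    _ ≤ _ := h1
    _ ≤ (25 / 2 * r) ^ 4 := by gcongr; linarith

theorem sum_row_vecMul {H V : Matrix (Fin 4) (Fin 4) ℝ} (hH : H * H.transpose = 1) :
    ∑ j, (H * V) j ⬝ᵥ (H * V) j = ∑ j, V j ⬝ᵥ V j := by
  have htr : ∀ M : Matrix (Fin 4) (Fin 4) ℝ,
      (M * M.transpose).trace = ∑ i, M i ⬝ᵥ M i := fun M => rfl
  rw [← htr, ← htr, Matrix.transpose_mul, Matrix.trace_mul_comm, Matrix.mul_assoc,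
    ← Matrix.mul_assoc H.transpose, mul_eq_one_comm.mp hH, Matrix.one_mul, Matrix.trace_mul_comm]

/-- The determinant bound for coverings by lattices of `D₄`-type. -/
theorem det_sq_le_of_d4Form {V : Matrix (Fin 4) (Fin 4) ℝ} (hV : V.det ≠ 0) {r : ℝ}
    (hcov : Covers d4Lat V (sqBall r)) {a b c : Fin 4 → ℝ} (ha : ∀ j, 0 ≤ a j)
    (hb : ∀ j, 0 ≤ b j) (hc : ∀ j, 0 ≤ c j)
    (hform : ∀ x, Matrix.vecMul x V ⬝ᵥ Matrix.vecMul x V = d4Form a b c x) :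
    12544 * V.det ^ 2 ≤ (25 / 2 * r) ^ 4 := by
  obtain ⟨m, hm⟩ := exists_le_of_d4Form hV hcov ha hb hc hform
  obtain ⟨i, hi⟩ := exists_le_of_d4Form (V := d4Hadamard * V)
    (by rw [Matrix.det_mul]; exact mul_ne_zero latIso_d4Hadamard.det_ne_zero hV)
    (hcov.of_latIso latIso_d4Hadamard) hb ha hc
    fun x => by rw [← Matrix.vecMul_vecMul, hform, d4Form_vecMul_d4Hadamard]
  obtain ⟨k, hk⟩ := exists_le_of_d4Form (V := d4Reflection * V)
    (by rw [Matrix.det_mul]; exact mul_ne_zero latIso_d4Reflection.det_ne_zero hV)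
    (hcov.of_latIso latIso_d4Reflection) hc hb ha
    fun x => by rw [← Matrix.vecMul_vecMul, hform, d4Form_vecMul_d4Reflection]
  rw [sum_row_vecMul] at hi hk
  · refine det_sq_le_of_frames ![Pi.single m 1, d4Hadamard i, d4Reflection k] ?_ ?_ ?_
    · intro j
      fin_cases j
      · simp
      · fin_cases i <;> simp [d4Hadamard, dotProduct, Fin.sum_univ_four] <;> norm_num
      · fin_cases k <;> simp [d4Reflection, dotProduct, Fin.sum_univ_four] <;> norm_num
    · have h01 : d4Hadamard i m = 1 / 2 ∨ d4Hadamard i m = -1 / 2 := by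
        fin_cases i <;> fin_cases m <;> simp [d4Hadamard]
      have h02 : d4Reflection k m = 1 / 2 ∨ d4Reflection k m = -1 / 2 := by
        fin_cases k <;> fin_cases m <;> simp [d4Reflection]
      have h12 : d4Hadamard i ⬝ᵥ d4Reflection k = 1 / 2 ∨
          d4Hadamard i ⬝ᵥ d4Reflection k = -1 / 2 := by
        fin_cases i <;> fin_cases k <;>
          simp [d4Hadamard, d4Reflection, dotProduct, Fin.sum_univ_four] <;> norm_num
      rw [one_div] at h01 h02 h12
      intro p q hpq
      fin_cases p <;> fin_cases q <;> simp at hpq ⊢ <;>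
        first
        | exact h01
        | exact h02
        | exact h12
        | (rw [dotProduct_comm]; exact h12)
    · have h0 : (Matrix.of ![Pi.single m 1, d4Hadamard i, d4Reflection k] * V) 0 = V m :=
        Matrix.single_one_vecMul m V
      have h1 : (Matrix.of ![Pi.single m 1, d4Hadamard i, d4Reflection k] * V) 1 =
          (d4Hadamard * V) i := rfl
      have h2 : (Matrix.of ![Pi.single m 1, d4Hadamard i, d4Reflection k] * V) 2 =
          (d4Reflection * V) k := rfl
      change _ + 4 * ∑ p, (Matrix.of ![Pi.single m 1, d4Hadamard i, d4Reflection k] * V) p ⬝ᵥ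
        (Matrix.of ![Pi.single m 1, d4Hadamard i, d4Reflection k] * V) p ≤ _
      rw [Fin.sum_univ_three, h0, h1, h2]
      linarith
  · ext p q
    fin_cases p <;> fin_cases q <;>
      simp [d4Reflection, Matrix.mul_apply, Fin.sum_univ_four] <;> norm_num
  · ext p q
    fin_cases p <;> fin_cases q <;>
      simp [d4Hadamard, Matrix.mul_apply, Fin.sum_univ_four] <;> norm_num

/-- The sum of the squared lengths of the rows. -/
def rowSqSum (V : Matrix (Fin 4) (Fin 4) ℝ) : ℝ := ∑ i, V i ⬝ᵥ V i

/-- The sum of the squared lengths of the rows and of their sum. -/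
def superSqSum (V : Matrix (Fin 4) (Fin 4) ℝ) : ℝ :=
  ∑ i, V i ⬝ᵥ V i + (V 0 + V 1 + V 2 + V 3) ⬝ᵥ (V 0 + V 1 + V 2 + V 3)

/-- The matrix whose rows are the signed standard basis vectors `ε j • e (π j)`. -/
def signedPerm (π : Equiv.Perm (Fin 4)) (ε : Fin 4 → ℤ) : Matrix (Fin 4) (Fin 4) ℝ :=
  Matrix.of fun j => Pi.single (π j) (ε j : ℝ)

theorem vecMul_signedPerm (π : Equiv.Perm (Fin 4)) (ε : Fin 4 → ℤ) (x : Fin 4 → ℝ) :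
    Matrix.vecMul x (signedPerm π ε) = fun k => x (π.symm k) * ε (π.symm k) := by
  ext k
  rw [Matrix.vecMul, dotProduct, Finset.sum_eq_single (π.symm k)]
  · simp [signedPerm]
  · intro j _ hj
    have : k ≠ π j := fun h => hj (by simp [h])
    simp [signedPerm, this]
  · simp

theorem signedPerm_mul_row (π : Equiv.Perm (Fin 4)) (ε : Fin 4 → ℤ)
    (V : Matrix (Fin 4) (Fin 4) ℝ) (j : Fin 4) :
    (signedPerm π ε * V) j = (ε j : ℝ) • V (π j) :=
  Matrix.single_vecMul ..

theorem vecMul_signedPerm_mem (π : Equiv.Perm (Fin 4)) {ε : Fin 4 → ℤ}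
    (hε : ∀ j, ε j = 1 ∨ ε j = -1) {x : Fin 4 → ℝ} (hx : x ∈ d4Lat) :
    Matrix.vecMul x (signedPerm π ε) ∈ d4Lat := by
  obtain ⟨n, hn, rfl⟩ := hx
  refine ⟨fun k => n (π.symm k) * ε (π.symm k), ?_, ?_⟩
  · have h1 : ∑ k, n (π.symm k) * ε (π.symm k) = ∑ j, n j * ε j :=
      Equiv.sum_comp π.symm fun j => n j * ε j
    have h2 : Even (∑ j, n j - ∑ j, n j * ε j) := by
      rw [← Finset.sum_sub_distrib]
      refine Finset.even_sum _ fun j _ => ?_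
      rcases hε j with h | h
      · simp [h]
      · exact ⟨n j, by rw [h]; ring⟩
    change Even (∑ k, n (π.symm k) * ε (π.symm k))
    rw [h1]
    exact (Int.even_sub.mp h2).mp hn
  · rw [vecMul_signedPerm]
    ext k
    simp [intVec]

theorem latIso_signedPerm (π : Equiv.Perm (Fin 4)) {ε : Fin 4 → ℤ}
    (hε : ∀ j, ε j = 1 ∨ ε j = -1) : LatIso d4Lat d4Lat (signedPerm π ε) := by
  refine LatIso.of_inverse (N := signedPerm π.symm (ε ∘ π.symm)) ?_
    (fun x hx => vecMul_signedPerm_mem π hε hx)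
    fun x hx => vecMul_signedPerm_mem π.symm (fun j => hε _) hx
  have h2 : ∀ j, (ε j : ℝ) * ε j = 1 := fun j => by rcases hε j with h | h <;> simp [h]
  funext j
  refine (signedPerm_mul_row π ε _ j).trans ?_
  ext k
  by_cases hk : k = j
  · subst hk; simp [signedPerm, h2]
  · simp [signedPerm, hk, Ne.symm hk]

theorem rowSqSum_d4Shear (V : Matrix (Fin 4) (Fin 4) ℝ) : rowSqSum (d4Shear * V) = rowSqSum V +
    (V 0 ⬝ᵥ V 0 + V 1 ⬝ᵥ V 2 + V 1 ⬝ᵥ V 3 + V 2 ⬝ᵥ V 3) := by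
  simp [rowSqSum, d4Shear, dotProduct, Fin.sum_univ_four, Matrix.mul_apply]
  ring

theorem superSqSum_d4Superbase (V : Matrix (Fin 4) (Fin 4) ℝ) : superSqSum (d4Superbase * V) =
    2 * rowSqSum V + 2 * (V 0 ⬝ᵥ V 0 + V 0 ⬝ᵥ V 1 + V 0 ⬝ᵥ V 2 + V 1 ⬝ᵥ V 2) := by
  simp [rowSqSum, superSqSum, d4Superbase, dotProduct, Fin.sum_univ_four, Matrix.mul_apply,
    Matrix.vecMul]
  ring

theorem injective_of_ne {a b c d : Fin 4} (hab : a ≠ b) (hac : a ≠ c) (had : a ≠ d)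
    (hbc : b ≠ c) (hbd : b ≠ d) (hcd : c ≠ d) : Function.Injective ![a, b, c, d] := by
  intro i j h
  fin_cases i <;> fin_cases j <;> simp_all [eq_comm]

theorem minimal_signed_ineq {V : Matrix (Fin 4) (Fin 4) ℝ}
    (hshear : ∀ M, LatIso d4Lat d4Lat M → rowSqSum V ≤ rowSqSum (M * V))
    (hbase : ∀ M, LatIso zLat d4Lat M → 2 * rowSqSum V ≤ superSqSum (M * V))
    {a b c d : Fin 4} (h : Function.Injective ![a, b, c, d]) {f g : ℤ}
    (hf : f = 1 ∨ f = -1) (hg : g = 1 ∨ g = -1) :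
    0 ≤ V a ⬝ᵥ V a + f * g * (V c ⬝ᵥ V d) + f * (V b ⬝ᵥ V c) + g * (V b ⬝ᵥ V d) ∧
    0 ≤ V a ⬝ᵥ V a + f * (V a ⬝ᵥ V b) + g * (V a ⬝ᵥ V c) + f * g * (V b ⬝ᵥ V c) := by
  set π : Equiv.Perm (Fin 4) := Equiv.ofBijective _ (Finite.injective_iff_bijective.mp h) with hπ
  have hπ0 : π 0 = a := rfl
  have hπ1 : π 1 = b := rfl
  have hπ2 : π 2 = c := rfl
  have hπ3 : π 3 = d := rfl
  have hrow : ∀ ε : Fin 4 → ℤ, (∀ j, ε j = 1 ∨ ε j = -1) →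
      rowSqSum (signedPerm π ε * V) = rowSqSum V := fun ε hε => by
    simp only [rowSqSum, signedPerm_mul_row, smul_dotProduct, dotProduct_smul, smul_eq_mul]
    rw [← Equiv.sum_comp π fun i => V i ⬝ᵥ V i]
    refine Finset.sum_congr rfl fun j _ => ?_
    rcases hε j with h | h <;> simp [h]
  constructor
  · have hε : ∀ j, (![1, 1, f, g] : Fin 4 → ℤ) j = 1 ∨ (![1, 1, f, g] : Fin 4 → ℤ) j = -1 := by
      simp [Fin.forall_fin_succ, hf, hg]
    have h1 := hshear _ (latIso_d4Shear.mul (latIso_signedPerm π hε))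
    rw [Matrix.mul_assoc, rowSqSum_d4Shear, hrow _ hε] at h1
    simp only [signedPerm_mul_row, smul_dotProduct, dotProduct_smul, smul_eq_mul, hπ0, hπ1, hπ2,
      hπ3] at h1
    simp at h1
    linarith
  · have hε : ∀ j, (![1, f, g, 1] : Fin 4 → ℤ) j = 1 ∨ (![1, f, g, 1] : Fin 4 → ℤ) j = -1 := by
      simp [Fin.forall_fin_succ, hf, hg]
    have h1 := hbase _ (latIso_d4Superbase.mul (latIso_signedPerm π hε))
    rw [Matrix.mul_assoc, superSqSum_d4Superbase, hrow _ hε] at h1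
    simp only [signedPerm_mul_row, smul_dotProduct, dotProduct_smul, smul_eq_mul, hπ0, hπ1, hπ2]
      at h1
    simp at h1
    linarith

theorem minimal_triple_ineq {V : Matrix (Fin 4) (Fin 4) ℝ}
    (hshear : ∀ M, LatIso d4Lat d4Lat M → rowSqSum V ≤ rowSqSum (M * V))
    (hbase : ∀ M, LatIso zLat d4Lat M → 2 * rowSqSum V ≤ superSqSum (M * V))
    {a b c d : Fin 4} (hab : a ≠ b) (hac : a ≠ c) (had : a ≠ d)
    (hbc : b ≠ c) (hbd : b ≠ d) (hcd : c ≠ d) (i : Fin 4) {f g : ℤ}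
    (hf : f = 1 ∨ f = -1) (hg : g = 1 ∨ g = -1) :
    0 ≤ V i ⬝ᵥ V i + f * (V a ⬝ᵥ V b) + g * (V a ⬝ᵥ V c) + f * g * (V b ⬝ᵥ V c) := by
  have hfg : f * g = 1 ∨ f * g = -1 := by
    rcases hf with rfl | rfl <;> rcases hg with rfl | rfl <;> simp
  have hf2 : (f : ℝ) * f = 1 := by rcases hf with rfl | rfl <;> simp
  have hg2 : (g : ℝ) * g = 1 := by rcases hg with rfl | rfl <;> simp
  obtain ⟨j, rfl⟩ := (Finite.injective_iff_surjective.mp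
    (injective_of_ne hab hac had hbc hbd hcd)) i
  fin_cases j
  · exact (minimal_signed_ineq hshear hbase
      (injective_of_ne hab hac had hbc hbd hcd) hf hg).2
  · have := (minimal_signed_ineq hshear hbase
      (injective_of_ne hab.symm hbc hbd hac had hcd) hf hfg).2
    rw [dotProduct_comm (V b) (V a)] at this
    push_cast at this
    rw [← mul_assoc, hf2, one_mul] at this
    change 0 ≤ V b ⬝ᵥ V b + _ + _ + _
    linarith
  · have := (minimal_signed_ineq hshear hbase
      (injective_of_ne hac.symm hbc.symm hcd hab had hbd) hg hfg).2
    rw [dotProduct_comm (V c) (V a), dotProduct_comm (V c) (V b)] at this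
    push_cast at this
    rw [mul_left_comm, hg2, mul_one] at this
    change 0 ≤ V c ⬝ᵥ V c + _ + _ + _
    linarith
  · have := (minimal_signed_ineq hshear hbase
      (injective_of_ne had.symm hbd.symm hcd.symm hab hac hbc) hf hg).1
    change 0 ≤ V d ⬝ᵥ V d + _ + _ + _
    linarith

theorem normSq_vecMul (V : Matrix (Fin 4) (Fin 4) ℝ) (x : Fin 4 → ℝ) :
    Matrix.vecMul x V ⬝ᵥ Matrix.vecMul x V =
      x 0 ^ 2 * (V 0 ⬝ᵥ V 0) + x 1 ^ 2 * (V 1 ⬝ᵥ V 1) + x 2 ^ 2 * (V 2 ⬝ᵥ V 2) +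
      x 3 ^ 2 * (V 3 ⬝ᵥ V 3) + 2 * (x 0 * x 1 * (V 0 ⬝ᵥ V 1) + x 0 * x 2 * (V 0 ⬝ᵥ V 2) +
      x 0 * x 3 * (V 0 ⬝ᵥ V 3) + x 1 * x 2 * (V 1 ⬝ᵥ V 2) + x 1 * x 3 * (V 1 ⬝ᵥ V 3) +
      x 2 * x 3 * (V 2 ⬝ᵥ V 3)) := by
  simp only [Matrix.vecMul, dotProduct, Fin.sum_univ_four]
  ring

theorem d4Form_shift (a b c x : Fin 4 → ℝ) (s t : ℝ) :
    d4Form (fun j => a j + (s + t)) (fun j => b j - s) (fun j => c j - t) x =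
      d4Form a b c x := by
  simp only [d4Form, vecMul_d4Hadamard, vecMul_d4Reflection, Fin.sum_univ_four]
  simp
  ring

/-- A frame that is minimal and not improved by passing to a superbase has a form of
`D₄`-type. -/
theorem exists_d4Form {V : Matrix (Fin 4) (Fin 4) ℝ}
    (hshear : ∀ M, LatIso d4Lat d4Lat M → rowSqSum V ≤ rowSqSum (M * V))
    (hbase : ∀ M, LatIso zLat d4Lat M → 2 * rowSqSum V ≤ superSqSum (M * V)) :
    ∃ a b c : Fin 4 → ℝ, (∀ j, 0 ≤ a j) ∧ (∀ j, 0 ≤ b j) ∧ (∀ j, 0 ≤ c j) ∧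
      ∀ x, Matrix.vecMul x V ⬝ᵥ Matrix.vecMul x V = d4Form a b c x := by
  set q : Fin 4 → Fin 4 → ℝ := fun i j => V i ⬝ᵥ V j with hq
  set a : Fin 4 → ℝ := fun i => q i i with ha
  set b : Fin 4 → ℝ := ![(q 0 1 + q 2 3 + (q 0 2 + q 1 3) + (q 0 3 + q 1 2)) / 2,
    (q 0 1 + q 2 3 - (q 0 2 + q 1 3) - (q 0 3 + q 1 2)) / 2,
    (-(q 0 1 + q 2 3) + (q 0 2 + q 1 3) - (q 0 3 + q 1 2)) / 2,
    (-(q 0 1 + q 2 3) - (q 0 2 + q 1 3) + (q 0 3 + q 1 2)) / 2] with hb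
  set c : Fin 4 → ℝ := ![(-(q 0 1 - q 2 3) - (q 0 2 - q 1 3) - (q 0 3 - q 1 2)) / 2,
    (-(q 0 1 - q 2 3) + (q 0 2 - q 1 3) + (q 0 3 - q 1 2)) / 2,
    ((q 0 1 - q 2 3) - (q 0 2 - q 1 3) + (q 0 3 - q 1 2)) / 2,
    ((q 0 1 - q 2 3) + (q 0 2 - q 1 3) - (q 0 3 - q 1 2)) / 2] with hc
  have hform : ∀ x, Matrix.vecMul x V ⬝ᵥ Matrix.vecMul x V = d4Form a b c x := fun x => by
    rw [normSq_vecMul]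
    simp only [d4Form, vecMul_d4Hadamard, vecMul_d4Reflection, Fin.sum_univ_four, ha, hb, hc]
    simp
    ring
  have habc : ∀ i j k, 0 ≤ a i + b j + c k := by
    intro i j k
    have h := fun (p q r s : Fin 4) h1 h2 h3 h4 h5 h6 (f g : ℤ) hf hg =>
      minimal_triple_ineq hshear hbase (a := p) (b := q) (c := r) (d := s) h1 h2 h3 h4 h5 h6 i
        (f := f) (g := g) hf hg
    have h0 := h 1 2 3 0 (by decide) (by decide) (by decide) (by decide) (by decide) (by decide)
    have h1 := h 0 2 3 1 (by decide) (by decide) (by decide) (by decide) (by decide) (by decide)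
    have h2 := h 0 1 3 2 (by decide) (by decide) (by decide) (by decide) (by decide) (by decide)
    have h3 := h 0 1 2 3 (by decide) (by decide) (by decide) (by decide) (by decide) (by decide)
    have t : ∀ {H : ℤ → ℤ → Prop}, (∀ f g : ℤ, (f = 1 ∨ f = -1) → (g = 1 ∨ g = -1) → H f g) →
        H 1 1 ∧ H 1 (-1) ∧ H (-1) 1 ∧ H (-1) (-1) := fun h =>
      ⟨h _ _ (by simp) (by simp), h _ _ (by simp) (by simp), h _ _ (by simp) (by simp),
        h _ _ (by simp) (by simp)⟩
    replace h0 := t h0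
    replace h1 := t h1
    replace h2 := t h2
    replace h3 := t h3
    push_cast at h0 h1 h2 h3
    fin_cases j <;> fin_cases k <;> simp [ha, hb, hc, hq] <;> linarith
  obtain ⟨j, -, hj⟩ := Finset.exists_min_image Finset.univ b Finset.univ_nonempty
  obtain ⟨k, -, hk⟩ := Finset.exists_min_image Finset.univ c Finset.univ_nonempty
  refine ⟨fun i => a i + (b j + c k), fun i => b i - b j, fun i => c i - c k, fun i => ?_,
    fun i => sub_nonneg.mpr (hj i (Finset.mem_univ i)),
    fun i => sub_nonneg.mpr (hk i (Finset.mem_univ i)), fun x => ?_⟩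
  · have := habc i j k
    linarith
  · rw [d4Form_shift, hform]

theorem exists_int_matrix_two_smul {P : Matrix (Fin 4) (Fin 4) ℝ} (hP : LatIso d4Lat zLat P) :
    ∃ Z : Matrix (Fin 4) (Fin 4) ℤ, P = (1 / 2 : ℝ) • Z.map (Int.cast : ℤ → ℝ) := by
  have h1 : ∀ i, ∃ n : Fin 4 → ℤ, intVec n = (2 : ℝ) • P i := by
    intro i
    obtain ⟨n, hn⟩ := hP.mapsTo (Pi.single i 2) ⟨Pi.single i 2, by simp, by
      ext j
      by_cases hj : j = i
      · subst hj; simp [intVec]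
      · simp [intVec, hj]⟩
    exact ⟨n, by rw [hn, Matrix.single_vecMul]; rfl⟩
  choose Z hZ using h1
  refine ⟨Matrix.of Z, ?_⟩
  ext i j
  have h2 : (Z i j : ℝ) = 2 * P i j := congrFun (hZ i) j
  simp [h2]

/-- There is a frame of minimal total squared length. -/
theorem exists_min_frame {A : Matrix (Fin 4) (Fin 4) ℝ} (hA : A.det ≠ 0) :
    ∃ P, LatIso d4Lat zLat P ∧
      ∀ P', LatIso d4Lat zLat P' → rowSqSum (P * A) ≤ rowSqSum (P' * A) := by
  set half : (Fin 4 → Fin 4 → ℤ) → Matrix (Fin 4) (Fin 4) ℝ := fun Z =>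
    (1 / 2 : ℝ) • (Matrix.of Z).map (Int.cast : ℤ → ℝ) with hhalf
  set B := rowSqSum (d4SuperbaseInv * A) with hB
  set F : Set (Fin 4 → Fin 4 → ℤ) :=
    {Z | LatIso d4Lat zLat (half Z) ∧ rowSqSum (half Z * A) ≤ B} with hF
  have hfin : F.Finite := by
    set C : ℝ := 2 * ∑ j, ∑ k, (B + 1) * |A⁻¹ k j| with hC
    set N : ℤ := ⌈C⌉ with hN
    refine (Set.finite_Icc (fun _ _ => -N) fun _ _ => N).subset ?_
    rintro Z ⟨-, hZ⟩
    have hent : ∀ i k, |(half Z * A) i k| ≤ B + 1 := by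
      intro i k
      have h1 : (half Z * A) i k * (half Z * A) i k ≤ (half Z * A) i ⬝ᵥ (half Z * A) i :=
        Finset.single_le_sum (f := fun k => (half Z * A) i k * (half Z * A) i k)
          (fun _ _ => mul_self_nonneg _) (Finset.mem_univ k)
      have h2 : (half Z * A) i ⬝ᵥ (half Z * A) i ≤ rowSqSum (half Z * A) :=
        Finset.single_le_sum (f := fun i => (half Z * A) i ⬝ᵥ (half Z * A) i)
          (fun _ _ => dotProduct_self_nonneg' _) (Finset.mem_univ i)
      have h3 : |(half Z * A) i k| ^ 2 ≤ B := by rw [sq_abs, sq]; linarith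
      nlinarith [abs_nonneg ((half Z * A) i k)]
    have hB0 : 0 ≤ B + 1 := (abs_nonneg _).trans (hent 0 0)
    have habs : ∀ i j, |(Z i j : ℝ)| ≤ C := by
      intro i j
      have h1 : half Z * A * A⁻¹ = half Z := by
        rw [Matrix.mul_assoc, Matrix.mul_nonsing_inv _ (isUnit_iff_ne_zero.mpr hA), Matrix.mul_one]
      have h2 : (Z i j : ℝ) = 2 * (half Z) i j := by simp [hhalf]
      rw [h2, ← h1, abs_mul, abs_two, hC]
      gcongr
      calc |(half Z * A * A⁻¹) i j| ≤ ∑ k, |(half Z * A) i k * A⁻¹ k j| :=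
            by rw [Matrix.mul_apply]; exact Finset.abs_sum_le_sum_abs _ _
        _ ≤ ∑ k, (B + 1) * |A⁻¹ k j| := Finset.sum_le_sum fun k _ => by
            rw [abs_mul]
            gcongr
            exact hent i k
        _ ≤ _ := Finset.single_le_sum (f := fun j => ∑ k, (B + 1) * |A⁻¹ k j|)
            (fun j _ => Finset.sum_nonneg fun k _ => by positivity) (Finset.mem_univ j)
    refine ⟨fun i j => ?_, fun i j => ?_⟩
    · have h1 := (abs_le.mp (habs i j)).1
      have h2 : -(N : ℝ) ≤ Z i j := by linarith [Int.le_ceil C]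
      exact_mod_cast h2
    · have h1 := (abs_le.mp (habs i j)).2
      have h2 : (Z i j : ℝ) ≤ N := by linarith [Int.le_ceil C]
      exact_mod_cast h2
  obtain ⟨Z₀, hZ₀⟩ := exists_int_matrix_two_smul latIso_d4SuperbaseInv
  have hne : F.Nonempty := ⟨Z₀, by
    change LatIso d4Lat zLat ((1 / 2 : ℝ) • Z₀.map (Int.cast : ℤ → ℝ)) ∧
      rowSqSum ((1 / 2 : ℝ) • Z₀.map (Int.cast : ℤ → ℝ) * A) ≤ B
    rw [← hZ₀]
    exact ⟨latIso_d4SuperbaseInv, le_rfl⟩⟩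
  obtain ⟨Z, hZ, hmin⟩ := Set.exists_min_image F (fun Z => rowSqSum (half Z * A)) hfin hne
  refine ⟨half Z, hZ.1, fun P' hP' => ?_⟩
  obtain ⟨Y, rfl⟩ := exists_int_matrix_two_smul hP'
  rcases le_total (rowSqSum ((1 / 2 : ℝ) • Y.map (Int.cast : ℤ → ℝ) * A)) B with h | h
  · exact hmin Y ⟨hP', h⟩
  · exact hZ.2.trans h

theorem det_d4Superbase : |d4Superbase.det| = 2 := by
  simp [d4Superbase, Matrix.det_succ_row_zero, Fin.sum_univ_succ, Fin.succAbove]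
  norm_num

theorem LatIso.abs_det_of_d4Lat {P : Matrix (Fin 4) (Fin 4) ℝ} (hP : LatIso d4Lat zLat P) :
    2 * |P.det| = 1 := by
  have := (latIso_d4Superbase.mul hP).abs_det
  rwa [Matrix.det_mul, abs_mul, det_d4Superbase] at this

/-- The determinant bound when the minimal frame beats every superbase. -/
theorem det_sq_le_of_min_frame {A P : Matrix (Fin 4) (Fin 4) ℝ} (hA : A.det ≠ 0)
    (hP : LatIso d4Lat zLat P)
    (hmin : ∀ P', LatIso d4Lat zLat P' → rowSqSum (P * A) ≤ rowSqSum (P' * A))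
    (hbase : ∀ W, LatIso zLat zLat W → 2 * rowSqSum (P * A) ≤ superSqSum (W * A)) {r : ℝ}
    (hcov : Covers zLat A (sqBall r)) : 3136 * A.det ^ 2 ≤ (25 / 2 * r) ^ 4 := by
  obtain ⟨a, b, c, ha, hb, hc, hform⟩ := exists_d4Form (V := P * A)
    (fun M hM => by
      rw [← Matrix.mul_assoc]
      exact hmin _ (hM.mul hP))
    fun M hM => by
      rw [← Matrix.mul_assoc]
      exact hbase _ (hM.mul hP)
  have hdet := hP.abs_det_of_d4Lat
  have h1 := det_sq_le_of_d4Form (V := P * A)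
    (by rw [Matrix.det_mul]; exact mul_ne_zero hP.det_ne_zero hA) (hcov.of_latIso hP) ha hb hc
    hform
  have h2 : P.det ^ 2 = 1 / 4 := by
    rw [← sq_abs]
    have : |P.det| = 1 / 2 := by linarith
    rw [this]; norm_num
  rw [Matrix.det_mul, mul_pow, h2] at h1
  linarith

/-- The rows of a matrix, preceded by the negative of their sum. -/
def superbase (V : Matrix (Fin 4) (Fin 4) ℝ) : Fin 5 → Fin 4 → ℝ :=
  ![-(V 0 + V 1 + V 2 + V 3), V 0, V 1, V 2, V 3]

theorem superbase_succ (V : Matrix (Fin 4) (Fin 4) ℝ) (i : Fin 4) : superbase V i.succ = V i := by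
  fin_cases i <;> rfl

theorem sum_superbase (V : Matrix (Fin 4) (Fin 4) ℝ) : ∑ k, superbase V k = 0 := by
  simp [superbase, Fin.sum_univ_succ]
  abel

theorem superSqSum_eq (V : Matrix (Fin 4) (Fin 4) ℝ) :
    superSqSum V = ∑ k, superbase V k ⬝ᵥ superbase V k := by
  rw [Fin.sum_univ_succ]
  simp only [superbase_succ, superSqSum]
  simp [superbase]
  ring

theorem vecMul_superbase_one (V : Matrix (Fin 4) (Fin 4) ℝ) (k : Fin 5) :
    Matrix.vecMul (superbase 1 k) V = superbase V k := by
  fin_cases k <;> ext j <;>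
    simp [superbase, Matrix.vecMul, dotProduct, Fin.sum_univ_four, Matrix.one_apply]
  ring

/-- The change of basis permuting a superbase. -/
def superPerm (σ : Equiv.Perm (Fin 5)) : Matrix (Fin 4) (Fin 4) ℝ :=
  Matrix.of fun i => superbase 1 (σ i.succ)

theorem superPerm_mul_row (σ : Equiv.Perm (Fin 5)) (V : Matrix (Fin 4) (Fin 4) ℝ) (i : Fin 4) :
    (superPerm σ * V) i = superbase V (σ i.succ) :=
  vecMul_superbase_one V (σ i.succ)

theorem superbase_superPerm_mul (σ : Equiv.Perm (Fin 5)) (V : Matrix (Fin 4) (Fin 4) ℝ)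
    (k : Fin 5) : superbase (superPerm σ * V) k = superbase V (σ k) := by
  refine Fin.cases ?_ (fun i => by rw [superbase_succ, superPerm_mul_row]) k
  have h1 := sum_superbase (superPerm σ * V)
  have h2 : ∑ k, superbase V (σ k) = 0 := by
    rw [Equiv.sum_comp σ (superbase V), sum_superbase]
  rw [Fin.sum_univ_succ] at h1 h2
  simp only [superbase_succ, superPerm_mul_row] at h1
  exact add_right_cancel (h1.trans h2.symm)

theorem superPerm_mul_inv (σ : Equiv.Perm (Fin 5)) : superPerm σ * superPerm σ⁻¹ = 1 := by
  have h : ∀ k, superbase (superPerm σ * superPerm σ⁻¹) k = superbase 1 k := fun k => by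
    rw [superbase_superPerm_mul, ← Matrix.mul_one (superPerm σ⁻¹), superbase_superPerm_mul]
    simp
  funext i
  rw [← superbase_succ (superPerm σ * superPerm σ⁻¹), h, superbase_succ]

theorem vecMul_superPerm_mem (σ : Equiv.Perm (Fin 5)) {x : Fin 4 → ℝ} (hx : x ∈ zLat) :
    Matrix.vecMul x (superPerm σ) ∈ zLat := by
  obtain ⟨n, rfl⟩ := hx
  have h : ∀ k, ∃ m : Fin 4 → ℤ, superbase 1 k = intVec m := by
    refine Fin.cases ⟨fun _ => -1, ?_⟩ fun i => ⟨Pi.single i 1, ?_⟩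
    · ext j
      fin_cases j <;> simp [superbase, intVec]
    · rw [superbase_succ]
      ext j
      simp [intVec, Matrix.one_apply, Pi.single_apply, eq_comm]
  choose m hm using h
  refine ⟨fun j => ∑ i, n i * m (σ i.succ) j, ?_⟩
  ext j
  simp [intVec, Matrix.vecMul, dotProduct, superPerm, hm]

theorem latIso_superPerm (σ : Equiv.Perm (Fin 5)) : LatIso zLat zLat (superPerm σ) :=
  LatIso.of_inverse (superPerm_mul_inv σ) (fun _ hx => vecMul_superPerm_mem σ hx)
    fun _ hx => vecMul_superPerm_mem σ⁻¹ hx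

theorem superSqSum_superPerm_mul (σ : Equiv.Perm (Fin 5)) (V : Matrix (Fin 4) (Fin 4) ℝ) :
    superSqSum (superPerm σ * V) = superSqSum V := by
  simp only [superSqSum_eq, superbase_superPerm_mul]
  exact Equiv.sum_comp σ fun k => superbase V k ⬝ᵥ superbase V k

theorem rowSqSum_d4SuperbaseInv (V : Matrix (Fin 4) (Fin 4) ℝ) :
    rowSqSum (d4SuperbaseInv * V) =
      superSqSum V / 2 - superbase V 2 ⬝ᵥ superbase V 3 := by
  simp [rowSqSum, superSqSum, superbase, d4SuperbaseInv, dotProduct, Fin.sum_univ_four,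
    Matrix.mul_apply]
  ring

theorem exists_perm_of_ne {i j p q : Fin 5} (hij : i ≠ j) (hpq : p ≠ q) :
    ∃ σ : Equiv.Perm (Fin 5), σ p = i ∧ σ q = j := by
  set τ := Equiv.swap p i
  have h1 : τ p = i := Equiv.swap_apply_left _ _
  refine ⟨τ.trans (Equiv.swap (τ q) j), ?_, ?_⟩
  · rw [Equiv.trans_apply, h1]
    refine Equiv.swap_apply_of_ne_of_ne (fun h => hpq ?_) hij
    exact τ.injective (h1.trans h)
  · rw [Equiv.trans_apply, Equiv.swap_apply_left]

/-- A superbase not beaten by the minimal frame is obtuse. -/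
theorem superbase_obtuse {A P W : Matrix (Fin 4) (Fin 4) ℝ}
    (hmin : ∀ P', LatIso d4Lat zLat P' → rowSqSum (P * A) ≤ rowSqSum (P' * A))
    (hW : LatIso zLat zLat W) (hWA : superSqSum (W * A) ≤ 2 * rowSqSum (P * A)) {i j : Fin 5}
    (hij : i ≠ j) : superbase (W * A) i ⬝ᵥ superbase (W * A) j ≤ 0 := by
  obtain ⟨σ, rfl, rfl⟩ := exists_perm_of_ne hij (by decide : (2 : Fin 5) ≠ 3)
  have h := hmin _ (latIso_d4SuperbaseInv.mul ((latIso_superPerm σ).mul hW))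
  rw [Matrix.mul_assoc, Matrix.mul_assoc, rowSqSum_d4SuperbaseInv, superSqSum_superPerm_mul,
    superbase_superPerm_mul, superbase_superPerm_mul] at h
  linarith

/-- The superbase formed by the rows and the negative of their sum is obtuse. -/
def IsObtuse (V : Matrix (Fin 4) (Fin 4) ℝ) : Prop :=
  (∀ i j, i ≠ j → V i ⬝ᵥ V j ≤ 0) ∧ ∀ i, 0 ≤ V i ⬝ᵥ (V 0 + V 1 + V 2 + V 3)

/-- The centroid of the simplex with vertices the partial sums of the superbase. -/
def simplexCentroid (V : Matrix (Fin 4) (Fin 4) ℝ) : Fin 4 → ℝ :=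
  (-1 / 5 : ℝ) • (V 0 + (2 : ℝ) • V 1 + (3 : ℝ) • V 2 + (4 : ℝ) • V 3)

/-- The mean squared distance of the vertices of the simplex from its centroid. -/
def simplexMoment (V : Matrix (Fin 4) (Fin 4) ℝ) : ℝ :=
  ((V 0 + V 1 + V 2 + V 3) ⬝ᵥ (V 0 + V 1 + V 2 + V 3) + (V 1 + V 2 + V 3) ⬝ᵥ (V 1 + V 2 + V 3) +
    (V 2 + V 3) ⬝ᵥ (V 2 + V 3) + V 3 ⬝ᵥ V 3) / 5 - simplexCentroid V ⬝ᵥ simplexCentroid V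

theorem int_sq_sub_nonneg (n : ℤ) : (0 : ℝ) ≤ (n : ℝ) ^ 2 - n := by
  have : 0 ≤ n ^ 2 - n := by
    rcases le_or_gt n 0 with h | h
    · nlinarith
    · nlinarith
  exact_mod_cast this

/-- The circumcentre of the simplex is a hole of the lattice. -/
theorem exists_hole {V : Matrix (Fin 4) (Fin 4) ℝ} (hV : V.det ≠ 0) (hobt : IsObtuse V) :
    ∃ x : Fin 4 → ℝ, (∀ l ∈ zLat, x ⬝ᵥ x ≤ (x - Matrix.vecMul l V) ⬝ᵥ (x - Matrix.vecMul l V)) ∧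
      x ⬝ᵥ x = simplexMoment V + (x - simplexCentroid V) ⬝ᵥ (x - simplexCentroid V) := by
  obtain ⟨x, hx⟩ := exists_dotProduct_eq hV
    ![(-(V 0 ⬝ᵥ V 1 + V 0 ⬝ᵥ V 2 + V 0 ⬝ᵥ V 3) - V 0 ⬝ᵥ (V 0 + V 1 + V 2 + V 3)) / 2,
      (-(V 1 ⬝ᵥ V 2 + V 1 ⬝ᵥ V 3) - (V 1 ⬝ᵥ (V 0 + V 1 + V 2 + V 3) - V 0 ⬝ᵥ V 1)) / 2,
      (-(V 2 ⬝ᵥ V 3) - (V 2 ⬝ᵥ (V 0 + V 1 + V 2 + V 3) - V 0 ⬝ᵥ V 2 - V 1 ⬝ᵥ V 2)) / 2,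
      (-(V 3 ⬝ᵥ (V 0 + V 1 + V 2 + V 3) - V 0 ⬝ᵥ V 3 - V 1 ⬝ᵥ V 3 - V 2 ⬝ᵥ V 3)) / 2]
  have hx0 := hx 0
  have hx1 := hx 1
  have hx2 := hx 2
  have hx3 := hx 3
  have hs : ∀ i j, V i ⬝ᵥ V j = V j ⬝ᵥ V i := fun i j => dotProduct_comm _ _
  simp at hx0 hx1 hx2 hx3
  refine ⟨x, ?_, ?_⟩
  · rintro l ⟨n, rfl⟩
    obtain ⟨h1, h2⟩ := hobt
    rw [sub_dotProduct_self, normSq_vecMul, vecMul_dotProduct_eq_sum, Fin.sum_univ_four, hx0, hx1,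
      hx2, hx3]
    have e01 := mul_nonneg (neg_nonneg.mpr (h1 0 1 (by decide))) (int_sq_sub_nonneg (n 0 - n 1))
    have e02 := mul_nonneg (neg_nonneg.mpr (h1 0 2 (by decide))) (int_sq_sub_nonneg (n 0 - n 2))
    have e03 := mul_nonneg (neg_nonneg.mpr (h1 0 3 (by decide))) (int_sq_sub_nonneg (n 0 - n 3))
    have e12 := mul_nonneg (neg_nonneg.mpr (h1 1 2 (by decide))) (int_sq_sub_nonneg (n 1 - n 2))
    have e13 := mul_nonneg (neg_nonneg.mpr (h1 1 3 (by decide))) (int_sq_sub_nonneg (n 1 - n 3))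
    have e23 := mul_nonneg (neg_nonneg.mpr (h1 2 3 (by decide))) (int_sq_sub_nonneg (n 2 - n 3))
    have d0 := mul_nonneg (h2 0) (int_sq_sub_nonneg (-n 0))
    have d1 := mul_nonneg (h2 1) (int_sq_sub_nonneg (-n 1))
    have d2 := mul_nonneg (h2 2) (int_sq_sub_nonneg (-n 2))
    have d3 := mul_nonneg (h2 3) (int_sq_sub_nonneg (-n 3))
    push_cast at e01 e02 e03 e12 e13 e23 d0 d1 d2 d3
    simp only [dotProduct_add, hs 1 0, hs 2 0, hs 3 0, hs 2 1, hs 3 1, hs 3 2, intVec] at *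
    linarith
  · rw [sub_dotProduct_self, simplexMoment]
    simp only [simplexCentroid, smul_dotProduct, add_dotProduct, smul_eq_mul, hx0, hx1, hx2, hx3,
      dotProduct_add, hs 1 0, hs 2 0, hs 3 0, hs 2 1, hs 3 1, hs 3 2]
    ring

/-- The matrix with permuted rows. -/
def permRows (π : Equiv.Perm (Fin 4)) (V : Matrix (Fin 4) (Fin 4) ℝ) :
    Matrix (Fin 4) (Fin 4) ℝ :=
  Matrix.of fun i => V (π i)

theorem vecMul_permRows (π : Equiv.Perm (Fin 4)) (V : Matrix (Fin 4) (Fin 4) ℝ)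
    (x : Fin 4 → ℝ) : Matrix.vecMul (x ∘ π) (permRows π V) = Matrix.vecMul x V := by
  ext j
  exact Equiv.sum_comp π fun i => x i * V i j

theorem Covers.permRows {V : Matrix (Fin 4) (Fin 4) ℝ} {K : Set (Fin 4 → ℝ)}
    (h : Covers zLat V K) (π : Equiv.Perm (Fin 4)) : Covers zLat (permRows π V) K := by
  intro x
  obtain ⟨_, ⟨n, rfl⟩, hn⟩ := h x
  refine ⟨_, ⟨n ∘ π, rfl⟩, ?_⟩
  rw [← vecMul_permRows π] at hn
  exact hn

theorem sum_permRows (π : Equiv.Perm (Fin 4)) (V : Matrix (Fin 4) (Fin 4) ℝ) :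
    permRows π V 0 + permRows π V 1 + permRows π V 2 + permRows π V 3 =
      V 0 + V 1 + V 2 + V 3 := by
  ext j
  have h := Equiv.sum_comp π fun i => V i j
  rw [Fin.sum_univ_four, Fin.sum_univ_four] at h
  exact h

theorem IsObtuse.permRows {V : Matrix (Fin 4) (Fin 4) ℝ} (h : IsObtuse V)
    (π : Equiv.Perm (Fin 4)) : IsObtuse (permRows π V) := by
  refine ⟨fun i j hij => h.1 _ _ (π.injective.ne hij), fun i => ?_⟩
  rw [sum_permRows]
  exact h.2 _

theorem det_permRows (π : Equiv.Perm (Fin 4)) {V : Matrix (Fin 4) (Fin 4) ℝ} (h : V.det ≠ 0) :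
    (permRows π V).det ≠ 0 := by
  have h1 : (permRows π V).det = Equiv.Perm.sign π * V.det := Matrix.det_permute π V
  rw [h1]
  rcases Int.units_eq_one_or (Equiv.Perm.sign π) with h | h <;> rw [h] <;> simpa

/-- A covering body that is close to the unit ball away from a pair of antipodal points. -/
def IsThinCap (e : Fin 4 → ℝ) (K : Set (Fin 4 → ℝ)) : Prop :=
  (∀ x ∈ K, x ⬝ᵥ x ≤ 1 + 3 / 1000000) ∧
    ∀ x ∈ K, 1 < x ⬝ᵥ x →
      ∃ s : ℤ, (s = 1 ∨ s = -1) ∧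
        (x - (s : ℝ) • e) ⬝ᵥ (x - (s : ℝ) • e) ≤ 5 / 1000000

theorem add_dotProduct_self_le (x y : Fin 4 → ℝ) :
    (x + y) ⬝ᵥ (x + y) ≤ 2 * (x ⬝ᵥ x + y ⬝ᵥ y) := by
  have h := dotProduct_self_nonneg' (x - y)
  rw [sub_dotProduct_self] at h
  rw [add_dotProduct, dotProduct_add, dotProduct_add, dotProduct_comm x y]
  linarith

theorem smul_dotProduct_self (a : ℝ) (x : Fin 4 → ℝ) :
    (a • x) ⬝ᵥ (a • x) = a ^ 2 * (x ⬝ᵥ x) := by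
  rw [smul_dotProduct, dotProduct_smul, smul_eq_mul, smul_eq_mul]
  ring

theorem intVec_sub (m n : Fin 4 → ℤ) : intVec (m - n) = intVec m - intVec n := by
  ext i; simp [intVec]

theorem intVec_smul (a : ℤ) (n : Fin 4 → ℤ) : intVec (a • n) = (a : ℝ) • intVec n := by
  ext i; simp [intVec]

theorem exists_deep_hole {e : Fin 4 → ℝ} {K : Set (Fin 4 → ℝ)} (hK : IsThinCap e K)
    {V : Matrix (Fin 4) (Fin 4) ℝ} (hV : V.det ≠ 0) (hobt : IsObtuse V)
    (hcov : Covers zLat V K) :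
    ∃ q : ℝ, 0 ≤ q ∧ simplexMoment V + q ≤ 1 + 3 / 1000000 ∧
      (1 < simplexMoment V + q → ∃ (n : Fin 4 → ℤ) (s : ℤ), (s = 1 ∨ s = -1) ∧
        (simplexCentroid V - Matrix.vecMul (intVec n) V - (s : ℝ) • e) ⬝ᵥ
          (simplexCentroid V - Matrix.vecMul (intVec n) V - (s : ℝ) • e) ≤
            2 * (q + 5 / 1000000)) := by
  obtain ⟨x, hx, hxx⟩ := exists_hole hV hobt
  obtain ⟨_, ⟨n, rfl⟩, hn⟩ := hcov x
  have hle := hx _ ⟨n, rfl⟩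
  refine ⟨_, dotProduct_self_nonneg' (x - simplexCentroid V), ?_, fun h => ?_⟩
  · rw [← hxx]
    exact hle.trans (hK.1 _ hn)
  · rw [← hxx] at h
    obtain ⟨s, hs, hse⟩ := hK.2 _ hn (h.trans_le hle)
    refine ⟨n, s, hs, ?_⟩
    have h1 := add_dotProduct_self_le (-(x - simplexCentroid V))
      (x - Matrix.vecMul (intVec n) V - (s : ℝ) • e)
    have h2 : -(x - simplexCentroid V) + (x - Matrix.vecMul (intVec n) V - (s : ℝ) • e) =
        simplexCentroid V - Matrix.vecMul (intVec n) V - (s : ℝ) • e := by abel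
    rw [h2, neg_dotProduct, dotProduct_neg, neg_neg] at h1
    linarith

/-- If the mean of two simplex moments exceeds one, one of the two holes is close to the cap. -/
theorem exists_deep_hole_pair {e : Fin 4 → ℝ} {K : Set (Fin 4 → ℝ)} (hK : IsThinCap e K)
    {V : Matrix (Fin 4) (Fin 4) ℝ} (hV : V.det ≠ 0) (hobt : IsObtuse V)
    (hcov : Covers zLat V K) {S : ℝ} (hS : 10 < S) (π π' : Equiv.Perm (Fin 4))
    (hππ : simplexMoment (permRows π V) + simplexMoment (permRows π' V) = S / 5)
    {k k' : Fin 4 → ℤ}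
    (hk : simplexCentroid (permRows π V) = (1 / 5 : ℝ) • Matrix.vecMul (intVec k) V)
    (hk' : simplexCentroid (permRows π' V) = (1 / 5 : ℝ) • Matrix.vecMul (intVec k') V) :
    S ≤ 101 / 10 ∧ ∃ (l : Fin 4 → ℤ) (s : ℤ) (u : Fin 4 → ℤ), (u = k ∨ u = k') ∧
      (s = 1 ∨ s = -1) ∧
      (Matrix.vecMul (intVec (u - (5 : ℤ) • l)) V - (5 * s : ℝ) • e) ⬝ᵥ
        (Matrix.vecMul (intVec (u - (5 : ℤ) • l)) V - (5 * s : ℝ) • e) ≤ 550 / 1000000 := by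
  have key : ∀ (π : Equiv.Perm (Fin 4)) (u : Fin 4 → ℤ) (q : ℝ) (n : Fin 4 → ℤ) (s : ℤ),
      simplexCentroid (permRows π V) = (1 / 5 : ℝ) • Matrix.vecMul (intVec u) V →
      q ≤ 6 / 1000000 →
      (simplexCentroid (permRows π V) - Matrix.vecMul (intVec n) (permRows π V) - (s : ℝ) • e) ⬝ᵥ
        (simplexCentroid (permRows π V) - Matrix.vecMul (intVec n) (permRows π V) -
          (s : ℝ) • e) ≤ 2 * (q + 5 / 1000000) →
      ∃ l : Fin 4 → ℤ, (Matrix.vecMul (intVec (u - (5 : ℤ) • l)) V - (5 * s : ℝ) • e) ⬝ᵥ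
        (Matrix.vecMul (intVec (u - (5 : ℤ) • l)) V - (5 * s : ℝ) • e) ≤ 550 / 1000000 := by
    intro π u q n s hu hq h
    refine ⟨n ∘ π.symm, ?_⟩
    have h1 : Matrix.vecMul (intVec n) (permRows π V) =
        Matrix.vecMul (intVec (n ∘ π.symm)) V := by
      rw [← vecMul_permRows π V]
      congr 1
      ext i
      simp [intVec]
    have h2 : Matrix.vecMul (intVec (u - (5 : ℤ) • (n ∘ π.symm))) V - (5 * s : ℝ) • e =
        (5 : ℝ) • (simplexCentroid (permRows π V) - Matrix.vecMul (intVec n) (permRows π V) -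
          (s : ℝ) • e) := by
      rw [h1, hu, intVec_sub, intVec_smul, Matrix.sub_vecMul, Matrix.smul_vecMul]
      ext i
      simp
      ring
    rw [h2, smul_dotProduct_self]
    linarith
  obtain ⟨q, hq, hq1, hq2⟩ := exists_deep_hole hK (det_permRows π hV) (hobt.permRows π)
    (hcov.permRows π)
  obtain ⟨q', hq', hq1', hq2'⟩ := exists_deep_hole hK (det_permRows π' hV) (hobt.permRows π')
    (hcov.permRows π')
  refine ⟨by linarith, ?_⟩
  rcases lt_or_ge 1 (simplexMoment (permRows π V) + q) with h | h
  · obtain ⟨n, s, hs, hns⟩ := hq2 h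
    obtain ⟨l, hl⟩ := key π k q n s hk (by linarith) hns
    exact ⟨l, s, k, Or.inl rfl, hs, hl⟩
  · obtain ⟨n, s, hs, hns⟩ := hq2' (by linarith)
    obtain ⟨l, hl⟩ := key π' k' q' n s hk' (by linarith) hns
    exact ⟨l, s, k', Or.inr rfl, hs, hl⟩

theorem posSemidef_one_add_ones : (1 + Matrix.of fun _ _ : Fin 4 => (1 : ℝ)).PosSemidef := by
  refine Matrix.PosSemidef.one.add ?_
  have h := Matrix.posSemidef_vecMulVec_self_star (fun _ : Fin 4 => (1 : ℝ))
  convert h using 1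
  ext i j
  simp [Matrix.vecMulVec]

theorem five_mul_det_sq_le (V : Matrix (Fin 4) (Fin 4) ℝ) :
    5 * V.det ^ 2 ≤ (superSqSum V / 4) ^ 4 := by
  have h := det_mul_det_sq_le_trace_pow posSemidef_one_add_ones V
  have h1 : (1 + Matrix.of fun _ _ : Fin 4 => (1 : ℝ)).det = 5 := by
    simp [Matrix.det_succ_row_zero, Fin.sum_univ_succ, Fin.succAbove, Matrix.one_apply]
    norm_num
  have h2 : ((1 + Matrix.of fun _ _ : Fin 4 => (1 : ℝ)) * (V * V.transpose)).trace =
      superSqSum V := by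
    simp [superSqSum, Matrix.trace, Matrix.mul_apply, Fin.sum_univ_four, dotProduct,
      Matrix.one_apply]
    ring
  rwa [h1, h2] at h

/-- A lattice with a short nonzero vector and bounded basis has small determinant. -/
theorem det_sq_le_of_short_vector {V : Matrix (Fin 4) (Fin 4) ℝ} {n : Fin 4 → ℤ} {i : Fin 4}
    (hn : n i ≠ 0)
    (hshort : Matrix.vecMul (intVec n) V ⬝ᵥ Matrix.vecMul (intVec n) V ≤ 1 / 100)
    (hrow : rowSqSum V ≤ 101 / 10) : 100 * V.det ^ 2 ≤ (111 / 40) ^ 4 := by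
  set v := Matrix.vecMul (intVec n) V with hv
  have h := det_mul_det_sq_le_trace_pow Matrix.PosSemidef.one (V.updateRow i ((10 : ℝ) • v))
  have h1 : (V.updateRow i ((10 : ℝ) • v)).det = 10 * (n i * V.det) := by
    rw [Matrix.det_updateRow_smul]
    congr 1
    have h2 := Matrix.det_updateRow_sum V i (intVec n)
    rw [smul_eq_mul] at h2
    rw [← show intVec n i = n i from rfl, ← h2]
    congr 2
  have h3 : (1 * (V.updateRow i ((10 : ℝ) • v) * (V.updateRow i ((10 : ℝ) • v)).transpose)).trace ≤
      111 / 10 := by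
    have h4 : (1 * (V.updateRow i ((10 : ℝ) • v) *
        (V.updateRow i ((10 : ℝ) • v)).transpose)).trace =
        100 * (v ⬝ᵥ v) + (rowSqSum V - V i ⬝ᵥ V i) := by
      fin_cases i <;>
      · simp [Matrix.trace, Matrix.mul_apply, Fin.sum_univ_four, dotProduct, rowSqSum,
          Matrix.updateRow_apply]
        ring
    have := dotProduct_self_nonneg' (V i)
    linarith
  have h5 : 0 ≤ (1 * (V.updateRow i ((10 : ℝ) • v) *
      (V.updateRow i ((10 : ℝ) • v)).transpose)).trace := by
    rw [Matrix.one_mul]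
    simp only [Matrix.trace, Matrix.diag, Matrix.mul_apply, Matrix.transpose_apply]
    exact Finset.sum_nonneg fun i _ => Finset.sum_nonneg fun j _ => mul_self_nonneg _
  have h6 : (1 : ℝ) ≤ (n i : ℝ) ^ 2 := by
    have : 1 ≤ n i ^ 2 := by
      have := sq_nonneg (n i)
      have := pow_ne_zero 2 hn
      omega
    exact_mod_cast this
  rw [Matrix.det_one, one_mul, h1] at h
  calc 100 * V.det ^ 2 ≤ (n i : ℝ) ^ 2 * (100 * V.det ^ 2) :=
        le_mul_of_one_le_left (by positivity) h6
    _ = (10 * (n i * V.det)) ^ 2 := by ring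
    _ ≤ _ := h
    _ ≤ (111 / 40) ^ 4 := pow_le_pow_left₀ (by linarith) (by linarith) 4

/-- The permutation with the given table of values. -/
def tablePerm (f : Fin 4 → Fin 4) (hf : Function.Bijective f) : Equiv.Perm (Fin 4) :=
  Equiv.ofBijective f hf

theorem vecMul_intVec_eq (n : Fin 4 → ℤ) (V : Matrix (Fin 4) (Fin 4) ℝ) :
    Matrix.vecMul (intVec n) V =
      (n 0 : ℝ) • V 0 + (n 1 : ℝ) • V 1 + (n 2 : ℝ) • V 2 + (n 3 : ℝ) • V 3 := by
  ext j
  simp [Matrix.vecMul, dotProduct, Fin.sum_univ_four, intVec]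

theorem det_sq_le_of_obtuse {e : Fin 4 → ℝ} {K : Set (Fin 4 → ℝ)} (hK : IsThinCap e K)
    {V : Matrix (Fin 4) (Fin 4) ℝ} (hV : V.det ≠ 0) (hobt : IsObtuse V)
    (hcov : Covers zLat V K) : V.det ^ 2 ≤ 125 / 16 := by
  by_contra! hdet
  have hS : 10 < superSqSum V := by
    by_contra! hS
    have h0 : 0 ≤ superSqSum V :=
      add_nonneg (Finset.sum_nonneg fun i _ => dotProduct_self_nonneg' _)
        (dotProduct_self_nonneg' _)
    have h1 := five_mul_det_sq_le V
    have h2 : (superSqSum V / 4) ^ 4 ≤ (10 / 4) ^ 4 :=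
      pow_le_pow_left₀ (by linarith) (by linarith) 4
    norm_num at h2
    linarith
  have hrow : ∀ π : Equiv.Perm (Fin 4), simplexCentroid (permRows π V) =
      (-1 / 5 : ℝ) • (V (π 0) + (2 : ℝ) • V (π 1) + (3 : ℝ) • V (π 2) + (4 : ℝ) • V (π 3)) :=
    fun π => rfl
  have hmom : ∀ π : Equiv.Perm (Fin 4), simplexMoment (permRows π V) =
      ((V (π 0) + V (π 1) + V (π 2) + V (π 3)) ⬝ᵥ (V (π 0) + V (π 1) + V (π 2) + V (π 3)) +
        (V (π 1) + V (π 2) + V (π 3)) ⬝ᵥ (V (π 1) + V (π 2) + V (π 3)) +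
        (V (π 2) + V (π 3)) ⬝ᵥ (V (π 2) + V (π 3)) + V (π 3) ⬝ᵥ V (π 3)) / 5 -
        simplexCentroid (permRows π V) ⬝ᵥ simplexCentroid (permRows π V) :=
    fun π => rfl
  obtain ⟨hS1, l, s, u, hu, hs, hl⟩ := exists_deep_hole_pair hK hV hobt hcov hS
    (tablePerm ![0, 1, 2, 3] (by decide)) (tablePerm ![1, 3, 0, 2] (by decide)) (by
      rw [hmom, hmom, hrow, hrow, superSqSum]
      simp [tablePerm, dotProduct, Fin.sum_univ_four]
      ring) (k := ![-1, -2, -3, -4]) (k' := ![-3, -1, -4, -2])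
    (by
      rw [hrow, vecMul_intVec_eq]
      ext j
      simp [tablePerm]
      ring)
    (by
      rw [hrow, vecMul_intVec_eq]
      ext j
      simp [tablePerm]
      ring)
  obtain ⟨-, l', s', u', hu', hs', hl'⟩ := exists_deep_hole_pair hK hV hobt hcov hS
    (tablePerm ![1, 0, 2, 3] (by decide)) (tablePerm ![0, 3, 1, 2] (by decide)) (by
      rw [hmom, hmom, hrow, hrow, superSqSum]
      simp [tablePerm, dotProduct, Fin.sum_univ_four]
      ring) (k := ![-2, -1, -3, -4]) (k' := ![-1, -3, -4, -2])
    (by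
      rw [hrow, vecMul_intVec_eq]
      ext j
      simp [tablePerm]
      ring)
    (by
      rw [hrow, vecMul_intVec_eq]
      ext j
      simp [tablePerm]
      ring)
  set w := u - (5 : ℤ) • l
  set w' := u' - (5 : ℤ) • l'
  have hne : ∃ i, (w - (s * s') • w') i ≠ 0 := by
    by_contra! hz
    have hz' : ∀ i, u i - 5 * l i - s * s' * (u' i - 5 * l' i) = 0 := hz
    have h0 := hz' 0
    have h1 := hz' 1
    have h2 := hz' 2
    have h3 := hz' 3
    rcases hu with rfl | rfl <;> rcases hu' with rfl | rfl <;> rcases hs with rfl | rfl <;>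
      rcases hs' with rfl | rfl <;> simp at h0 h1 h2 h3 <;> omega
  obtain ⟨i, hi⟩ := hne
  have hshort : Matrix.vecMul (intVec (w - (s * s') • w')) V ⬝ᵥ
      Matrix.vecMul (intVec (w - (s * s') • w')) V ≤ 1 / 100 := by
    have hss : ((s * s' : ℤ) : ℝ) ^ 2 = 1 := by
      rcases hs with rfl | rfl <;> rcases hs' with rfl | rfl <;> norm_num
    have hss' : ((s * s' : ℤ) : ℝ) * s' = s := by
      rcases hs with rfl | rfl <;> rcases hs' with rfl | rfl <;> norm_num
    have h1 := add_dotProduct_self_le (Matrix.vecMul (intVec w) V - (5 * s : ℝ) • e)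
      (-((s * s' : ℤ) : ℝ) • (Matrix.vecMul (intVec w') V - (5 * s' : ℝ) • e))
    have h2 : Matrix.vecMul (intVec w) V - (5 * s : ℝ) • e +
        -((s * s' : ℤ) : ℝ) • (Matrix.vecMul (intVec w') V - (5 * s' : ℝ) • e) =
        Matrix.vecMul (intVec (w - (s * s') • w')) V := by
      rw [intVec_sub w, intVec_smul (s * s') w', Matrix.sub_vecMul, Matrix.smul_vecMul]
      ext j
      simp only [Pi.add_apply, Pi.sub_apply, Pi.smul_apply, smul_eq_mul]
      linear_combination 5 * e j * hss'
    rw [h2, smul_dotProduct_self, neg_sq, hss] at h1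
    linarith
  have hsum : rowSqSum V ≤ 101 / 10 := by
    have := dotProduct_self_nonneg' (V 0 + V 1 + V 2 + V 3)
    rw [superSqSum] at hS1
    rw [rowSqSum]
    linarith
  have := det_sq_le_of_short_vector hi hshort hsum
  norm_num at this
  linarith

/-- The covering determinant bound for bodies that are close to the ball. -/
theorem det_sq_le_of_covers {e : Fin 4 → ℝ} {K : Set (Fin 4 → ℝ)} (hK : IsThinCap e K)
    {A : Matrix (Fin 4) (Fin 4) ℝ} (hA : A.det ≠ 0) (hcov : Covers zLat A K) :
    A.det ^ 2 ≤ 125 / 16 := by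
  obtain ⟨P, hP, hmin⟩ := exists_min_frame hA
  by_cases hbase : ∀ W, LatIso zLat zLat W → 2 * rowSqSum (P * A) ≤ superSqSum (W * A)
  · have h := det_sq_le_of_min_frame hA hP hmin hbase (hcov.mono hK.1)
    norm_num at h
    linarith
  · push Not at hbase
    obtain ⟨W, hW, hWA⟩ := hbase
    have hobt := fun i j => superbase_obtuse (i := i) (j := j) hmin hW hWA.le
    have hWobt : IsObtuse (W * A) := by
      refine ⟨fun i j hij => ?_, fun i => ?_⟩
      · rw [← superbase_succ (W * A) i, ← superbase_succ (W * A) j]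
        exact hobt _ _ (fun h => hij (Fin.succ_injective _ h))
      · have h := hobt i.succ 0 (Fin.succ_ne_zero i)
        rw [superbase_succ] at h
        change _ ⬝ᵥ -((W * A) 0 + (W * A) 1 + (W * A) 2 + (W * A) 3) ≤ 0 at h
        rw [dotProduct_neg] at h
        linarith
    have h := det_sq_le_of_obtuse hK
      (by rw [Matrix.det_mul]; exact mul_ne_zero hW.det_ne_zero hA) hWobt (hcov.of_latIso hW)
    rwa [Matrix.det_mul, mul_pow, ← sq_abs W.det, hW.abs_det, one_pow, one_mul] at h

/-- The rows are the images of the standard basis vectors. -/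
def rowMatrix (T : Euc 4 →ₗ[ℝ] Euc 4) : Matrix (Fin 4) (Fin 4) ℝ :=
  (LinearMap.toMatrix (EuclideanSpace.basisFun (Fin 4) ℝ).toBasis
    (EuclideanSpace.basisFun (Fin 4) ℝ).toBasis T).transpose

theorem det_rowMatrix (T : Euc 4 →ₗ[ℝ] Euc 4) : (rowMatrix T).det = LinearMap.det T := by
  rw [rowMatrix, Matrix.det_transpose, LinearMap.det_toMatrix]

theorem vecMul_rowMatrix (T : Euc 4 →ₗ[ℝ] Euc 4) (x : Euc 4) :
    Matrix.vecMul x.ofLp (rowMatrix T) = (T x).ofLp := by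
  rw [rowMatrix, Matrix.vecMul_transpose]
  have h := LinearMap.toMatrix_mulVec_repr (EuclideanSpace.basisFun (Fin 4) ℝ).toBasis
    (EuclideanSpace.basisFun (Fin 4) ℝ).toBasis T x
  have hrepr : ∀ y, ⇑((EuclideanSpace.basisFun (Fin 4) ℝ).toBasis.repr y) = y.ofLp := fun y => by
    ext i
    simp
  rwa [hrepr, hrepr] at h

theorem exists_rowMatrix (A : Matrix (Fin 4) (Fin 4) ℝ) : ∃ T, rowMatrix T = A :=
  ⟨Matrix.toLin (EuclideanSpace.basisFun (Fin 4) ℝ).toBasis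
    (EuclideanSpace.basisFun (Fin 4) ℝ).toBasis A.transpose, by
    rw [rowMatrix, LinearMap.toMatrix_toLin, Matrix.transpose_transpose]⟩

theorem mem_intPoints_iff {x : Euc 4} : x ∈ intPoints 4 ↔ x.ofLp ∈ zLat := by
  constructor
  · intro h
    choose m hm using h
    exact ⟨m, funext fun i => (hm i).symm⟩
  · rintro ⟨m, hm⟩ i
    exact ⟨m i, (congrFun hm i).symm⟩

/-- The coordinate vectors of the points of a set. -/
def coords (K : Set (Euc 4)) : Set (Fin 4 → ℝ) := {x | WithLp.toLp 2 x ∈ K}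

theorem isCoveringLattice_iff (T : Euc 4 →ₗ[ℝ] Euc 4) (K : Set (Euc 4)) :
    IsCoveringLattice T K ↔ Covers zLat (rowMatrix T) (coords K) := by
  rw [IsCoveringLattice, Set.eq_univ_iff_forall]
  constructor
  · intro h x
    obtain ⟨_, ⟨l, hl, rfl⟩, hx⟩ : ∃ l ∈ T '' intPoints 4, WithLp.toLp 2 x ∈ l +ᵥ K := by
      simpa only [Set.mem_iUnion, exists_prop] using h (WithLp.toLp 2 x)
    refine ⟨l.ofLp, mem_intPoints_iff.mp hl, ?_⟩
    rw [Set.mem_vadd_set_iff_neg_vadd_mem, vadd_eq_add, neg_add_eq_sub] at hx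
    rw [vecMul_rowMatrix]
    exact hx
  · intro h x
    obtain ⟨l, hl, hx⟩ := h x.ofLp
    have h1 : T (WithLp.toLp 2 l) ∈ T '' intPoints 4 :=
      ⟨WithLp.toLp 2 l, mem_intPoints_iff.mpr hl, rfl⟩
    refine Set.mem_biUnion h1 ?_
    rw [Set.mem_vadd_set_iff_neg_vadd_mem, vadd_eq_add, neg_add_eq_sub]
    have h2 := vecMul_rowMatrix T (WithLp.toLp 2 l)
    change Matrix.vecMul l (rowMatrix T) = _ at h2
    rw [h2] at hx
    exact hx

theorem critCoveringDet_eq {K : Set (Euc 4)} {e : Fin 4 → ℝ} (hK : IsThinCap e (coords K))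
    {A : Matrix (Fin 4) (Fin 4) ℝ} (hA : A.det ^ 2 = 125 / 16) (hcov : Covers zLat A (coords K)) :
    critCoveringDet K = √(125 / 16) := by
  obtain ⟨T, rfl⟩ := exists_rowMatrix A
  refine IsGreatest.csSup_eq ⟨⟨T, ?_, (isCoveringLattice_iff T K).mpr hcov, ?_⟩, ?_⟩
  · rw [← det_rowMatrix]
    intro h
    rw [h] at hA
    norm_num at hA
  · rw [← hA, Real.sqrt_sq_eq_abs, det_rowMatrix]
  · rintro _ ⟨T', hT', hT'K, rfl⟩
    rw [← det_rowMatrix] at hT' ⊢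
    exact Real.abs_le_sqrt (det_sq_le_of_covers hK hT' ((isCoveringLattice_iff T' K).mp hT'K))

/-- The unit ball enlarged by two opposite caps of height `10⁻⁶`. -/
def cappedBall : Set (Euc 4) :=
  {x | ‖x‖ ≤ 1000001 / 1000000 ∧
    ∀ w : Euc 4, ‖w‖ ≤ 1 → |w 0| ≤ 1000000 / 1000001 → inner ℝ x w ≤ 1}

theorem isSymmConvexBody_cappedBall_and_ssubset :
    IsSymmConvexBody cappedBall ∧ unitBall 4 ⊂ cappedBall := by
  have hsub : unitBall 4 ⊆ cappedBall := by
    intro x hx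
    rw [unitBall, mem_closedBall_zero_iff] at hx
    refine ⟨hx.trans (by norm_num), fun w hw _ => (real_inner_le_norm x w).trans ?_⟩
    exact mul_le_one₀ hx (norm_nonneg _) hw
  have heq : cappedBall = Metric.closedBall 0 (1000001 / 1000000) ∩
      ⋂ w ∈ {w : Euc 4 | ‖w‖ ≤ 1 ∧ |w 0| ≤ 1000000 / 1000001}, {x | inner ℝ x w ≤ 1} := by
    ext x
    simp [cappedBall]
  refine ⟨⟨?_, ?_, ?_, ?_⟩, hsub, fun h => ?_⟩
  · rw [heq]
    refine (isCompact_closedBall _ _).inter_right (isClosed_biInter fun w _ => ?_)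
    exact isClosed_le (by fun_prop) continuous_const
  · rw [heq]
    refine (convex_closedBall _ _).inter (convex_iInter₂ fun w _ => ?_)
    refine convex_halfSpace_le ⟨fun x y => inner_add_left x y w, fun a x => ?_⟩ 1
    rw [inner_smul_left]
    rfl
  · refine ⟨0, mem_interior_iff_mem_nhds.mpr ?_⟩
    exact Filter.mem_of_superset (Metric.closedBall_mem_nhds 0 one_pos) hsub
  · have hneg : ∀ x ∈ cappedBall, -x ∈ cappedBall := by
      rintro x ⟨h1, h2⟩
      refine ⟨by rwa [norm_neg], fun w hw hw0 => ?_⟩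
      have := h2 (-w) (by rwa [norm_neg]) (by simpa using hw0)
      rwa [inner_neg_right, ← inner_neg_left] at this
    ext x
    rw [Set.mem_neg]
    exact ⟨hneg x, fun h => by simpa using hneg _ h⟩
  · have hmem : EuclideanSpace.single 0 (1000001 / 1000000 : ℝ) ∈ cappedBall := by
      refine ⟨by rw [PiLp.norm_single]; norm_num, fun w _ hw => ?_⟩
      have := (abs_le.mp hw).2
      rw [EuclideanSpace.inner_single_left]
      simp only [conj_trivial]
      linarith
    have := h hmem
    rw [unitBall, mem_closedBall_zero_iff, PiLp.norm_single] at this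
    norm_num at this

theorem norm_toLp_sq (x : Fin 4 → ℝ) : ‖WithLp.toLp 2 x‖ ^ 2 = x ⬝ᵥ x := by
  rw [EuclideanSpace.real_norm_sq_eq]
  simp [dotProduct, sq]

theorem isThinCap_unitBall (e : Fin 4 → ℝ) : IsThinCap e (coords (unitBall 4)) := by
  have h : ∀ x ∈ coords (unitBall 4), x ⬝ᵥ x ≤ 1 := by
    intro x hx
    rw [coords, Set.mem_ofPred_eq, unitBall, mem_closedBall_zero_iff] at hx
    rw [← norm_toLp_sq]
    exact pow_le_one₀ (norm_nonneg _) hx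
  exact ⟨fun x hx => (h x hx).trans (by norm_num), fun x hx hx1 => absurd (h x hx) hx1.not_ge⟩

theorem isThinCap_cappedBall : IsThinCap (Pi.single 0 1) (coords cappedBall) := by
  have h : ∀ x ∈ coords cappedBall, x ⬝ᵥ x ≤ (1000001 / 1000000) ^ 2 := by
    intro x hx
    rw [← norm_toLp_sq]
    exact pow_le_pow_left₀ (norm_nonneg _) hx.1 2
  refine ⟨fun x hx => (h x hx).trans (by norm_num), fun x hx hx1 => ?_⟩
  have hx2 := h x hx
  rw [← norm_toLp_sq, one_lt_sq_iff₀ (norm_nonneg _)] at hx1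
  have hx0 : 1000000 / 1000001 < |x 0| := by
    by_contra! hle
    have hpos : 0 < ‖WithLp.toLp 2 x‖ := by linarith
    have h1 := hx.2 (‖WithLp.toLp 2 x‖⁻¹ • WithLp.toLp 2 x)
      (by rw [norm_smul, norm_inv, norm_norm, inv_mul_cancel₀ hpos.ne'])
      (by
        rw [PiLp.smul_apply, smul_eq_mul, abs_mul, abs_inv, abs_norm]
        exact (mul_le_of_le_one_left (abs_nonneg _) (inv_le_one_of_one_le₀ hx1.le)).trans hle)
    rw [inner_smul_right, real_inner_self_eq_norm_sq, sq, inv_mul_cancel_left₀ hpos.ne'] at h1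
    linarith
  have hexp : ∀ s : ℝ, (x - s • Pi.single 0 1) ⬝ᵥ (x - s • Pi.single 0 1) =
      x ⬝ᵥ x - 2 * (s * x 0) + s ^ 2 := by
    intro s
    rw [sub_dotProduct_self, smul_dotProduct_self, smul_dotProduct]
    simp
  rcases lt_abs.mp hx0 with h0 | h0
  · refine ⟨1, Or.inl rfl, ?_⟩
    rw [hexp]
    norm_num at hx2 ⊢
    linarith
  · refine ⟨-1, Or.inr rfl, ?_⟩
    rw [hexp]
    norm_num at hx2 ⊢
    linarith

/-- The quadratic form `∑ i < j, (y i - y j) ^ 2` of the lattice `A₄*`. -/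
def pairForm (y : Fin 5 → ℝ) : ℝ := 5 * ∑ i, y i ^ 2 - (∑ i, y i) ^ 2

theorem pairForm_sub_const (y : Fin 5 → ℝ) (a : ℝ) : pairForm (fun i => y i - a) = pairForm y := by
  simp only [pairForm, Fin.sum_univ_five]
  ring

theorem exists_pairForm_le_of_sorted {a b c d e : ℝ} (hab : a ≤ b) (hbc : b ≤ c) (hcd : c ≤ d)
    (hde : d ≤ e) (hea : e < a + 1) :
    ∃ z : Fin 5 → ℤ, pairForm (fun i => ![a, b, c, d, e] i - z i) ≤ 2 := by
  by_contra! h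
  have h0 := mul_pos (by linarith : 0 < 1 - (e - a)) (sub_pos.mpr (h ![0, 0, 0, 0, 0]))
  have h1 := mul_nonneg (sub_nonneg.mpr hde) (sub_pos.mpr (h ![0, 0, 0, 0, 1])).le
  have h2 := mul_nonneg (sub_nonneg.mpr hcd) (sub_pos.mpr (h ![0, 0, 0, 1, 1])).le
  have h3 := mul_nonneg (sub_nonneg.mpr hbc) (sub_pos.mpr (h ![0, 0, 1, 1, 1])).le
  have h4 := mul_nonneg (sub_nonneg.mpr hab) (sub_pos.mpr (h ![0, 1, 1, 1, 1])).le
  have hsq : 0 ≤ (b - a - 1 / 5) ^ 2 + (c - a - 2 / 5) ^ 2 + (d - a - 3 / 5) ^ 2 +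
      (e - a - 4 / 5) ^ 2 + (c - b - 1 / 5) ^ 2 + (d - b - 2 / 5) ^ 2 + (e - b - 3 / 5) ^ 2 +
      (d - c - 1 / 5) ^ 2 + (e - c - 2 / 5) ^ 2 + (e - d - 1 / 5) ^ 2 := by positivity
  simp [pairForm, Fin.sum_univ_five] at h0 h1 h2 h3 h4
  linarith

theorem exists_pairForm_le (y : Fin 5 → ℝ) :
    ∃ z : Fin 5 → ℤ, pairForm (fun i => y i - z i) ≤ 2 := by
  set f : Fin 5 → ℝ := fun i => Int.fract (y i) with hf
  set σ := Tuple.sort f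
  have hmono : Monotone (f ∘ σ) := Tuple.monotone_sort f
  obtain ⟨z, hz⟩ := exists_pairForm_le_of_sorted (a := f (σ 0)) (b := f (σ 1)) (c := f (σ 2))
    (d := f (σ 3)) (e := f (σ 4)) (hmono (by decide)) (hmono (by decide)) (hmono (by decide))
    (hmono (by decide))
    (by linarith [Int.fract_lt_one (y (σ 4)), Int.fract_nonneg (y (σ 0))])
  refine ⟨fun i => ⌊y i⌋ + z (σ.symm i), ?_⟩
  refine le_of_eq_of_le ?_ hz
  have h1 : ∀ i, ![f (σ 0), f (σ 1), f (σ 2), f (σ 3), f (σ 4)] i = f (σ i) := by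
    intro i
    fin_cases i <;> rfl
  have h2 : ∀ i, y (σ i) - ((⌊y (σ i)⌋ + z (σ.symm (σ i)) : ℤ) : ℝ) = f (σ i) - z i := by
    intro i
    rw [Equiv.symm_apply_apply, hf, Int.cast_add, ← sub_sub, Int.self_sub_floor]
  simp only [pairForm, h1, ← h2]
  rw [Equiv.sum_comp σ fun i => (y i - ((⌊y i⌋ + z (σ.symm i) : ℤ) : ℝ)) ^ 2,
    Equiv.sum_comp σ fun i => y i - ((⌊y i⌋ + z (σ.symm i) : ℤ) : ℝ)]

/-- The lattice `A₄*`, scaled to covering radius one. -/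
theorem exists_covers_unitBall : ∃ A : Matrix (Fin 4) (Fin 4) ℝ, A.det ^ 2 = 125 / 16 ∧
    Covers zLat A (coords (unitBall 4)) := by
  obtain ⟨s, hs⟩ : ∃ s : ℝ, s ^ 2 = 1 / 2 := ⟨_, Real.sq_sqrt (by norm_num)⟩
  obtain ⟨t, ht⟩ : ∃ t : ℝ, t ^ 2 = 5 / 2 := ⟨_, Real.sq_sqrt (by norm_num)⟩
  set A : Matrix (Fin 4) (Fin 4) ℝ := Matrix.of fun i j =>
    (if i = j then t else 0) + (s - t) / 4 with hA
  have hG : A * A.transpose = Matrix.of fun i j => if i = j then 2 else -1 / 2 := by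
    ext i j
    fin_cases i <;> fin_cases j <;> simp [hA, Matrix.mul_apply, Fin.sum_univ_four] <;>
      linarith
  have hdet : A.det ^ 2 = 125 / 16 := by
    have h := congrArg Matrix.det hG
    rw [Matrix.det_mul, Matrix.det_transpose, ← sq] at h
    rw [h]
    simp [Matrix.det_succ_row_zero, Fin.sum_univ_succ, Fin.succAbove]
    norm_num
  have hnorm : ∀ w, Matrix.vecMul w A ⬝ᵥ Matrix.vecMul w A =
      (5 * ∑ i, w i ^ 2 - (∑ i, w i) ^ 2) / 2 := by
    intro w
    have h : Matrix.vecMul w A ⬝ᵥ Matrix.vecMul w A =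
        Matrix.vecMul w (A * A.transpose) ⬝ᵥ w := by
      rw [← Matrix.vecMul_vecMul, Matrix.vecMul_transpose, dotProduct_comm,
        ← Matrix.dotProduct_mulVec, dotProduct_comm]
    rw [h, hG]
    simp [Matrix.vecMul, dotProduct, Fin.sum_univ_four]
    ring
  refine ⟨A, hdet, fun x => ?_⟩
  obtain ⟨y, rfl⟩ : ∃ y, Matrix.vecMul y A = x := by
    refine ⟨Matrix.vecMul x A⁻¹, ?_⟩
    rw [Matrix.vecMul_vecMul, Matrix.nonsing_inv_mul, Matrix.vecMul_one]
    refine isUnit_iff_ne_zero.mpr fun h => ?_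
    rw [h] at hdet
    norm_num at hdet
  obtain ⟨z, hz⟩ := exists_pairForm_le (Fin.cons 0 y)
  refine ⟨_, ⟨fun i => z i.succ - z 0, rfl⟩, ?_⟩
  rw [← Matrix.sub_vecMul, coords, Set.mem_ofPred_eq, unitBall, mem_closedBall_zero_iff,
    ← sq_le_one_iff₀ (norm_nonneg _), norm_toLp_sq, hnorm]
  rw [← pairForm_sub_const _ (-(z 0 : ℝ)), pairForm,
    Fin.sum_univ_succ, Fin.sum_univ_succ (n := 4) (f := fun i => _ - _)] at hz
  simp only [Fin.cons_zero, Fin.cons_succ] at hz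
  have h : ∀ i, (y - intVec fun i => z i.succ - z 0) i = y i - z i.succ - -(z 0 : ℝ) := by
    intro i
    simp [intVec]
    ring
  simp only [h]
  linarith

/-- The ball `B⁴` is extensible: some origin-symmetric convex body properly containing
`B⁴` has the same critical covering determinant as `B⁴`. -/
theorem ball4_extensible :
    ∃ K : Set (Euc 4), IsSymmConvexBody K ∧ unitBall 4 ⊂ K ∧
      critCoveringDet K = critCoveringDet (unitBall 4) := by
  obtain ⟨A, hA, hcov⟩ := exists_covers_unitBall
  obtain ⟨hbody, hsub⟩ := isSymmConvexBody_cappedBall_and_ssubset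
  refine ⟨cappedBall, hbody, hsub, ?_⟩
  rw [critCoveringDet_eq isThinCap_cappedBall hA (hcov.mono fun _ hx => hsub.subset hx),
    critCoveringDet_eq (isThinCap_unitBall 0) hA hcov]
end
end
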